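/- Let T = K⟦x, y₁, ..., y_n⟧/((x) ∩ (y₁,...,y_n)) where K is a field and n > 1. Then T has exactly two minimal primes P₁ and P₂ with dim(T/P₁) = n and dim(T/P₂) = 1, and T is not equidimensional; consequently any Noetherian local domain A with Â ≅ T is catenary but not universally catenary. -/

import Mathlib

open IsLocalRing

/-- A chain of primes indexed by `Fin (n+1)` is saturated if each step is a covering
relation in `Spec`. -/
def IsSaturatedChain {R : Type} [CommRing R] {n : ℕ} (f : Fin (n + 1) → PrimeSpectrum R) : Prop :=
  ∀ i : Fin n, f i.castSucc ⋖ f i.succ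

/-- A ring is catenary if any two saturated chains of primes with the same endpoints have
the same length. -/
def IsCatenary (R : Type) [CommRing R] : Prop :=
  ∀ (n m : ℕ) (f : Fin (n + 1) → PrimeSpectrum R) (g : Fin (m + 1) → PrimeSpectrum R),
    IsSaturatedChain f → IsSaturatedChain g → f 0 = g 0 →
    f (Fin.last n) = g (Fin.last m) → n = m

/-- A ring is universally catenary if every polynomial ring over it in finitely many
variables is catenary. -/
def IsUniversallyCatenary (R : Type) [CommRing R] : Prop :=
  ∀ n : ℕ, IsCatenary (MvPolynomial (Fin n) R)

/-- A ring is equidimensional if `dim (R/P) = dim R` for every minimal prime `P`. -/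
def IsEquidimensional (R : Type) [CommRing R] : Prop :=
  ∀ P ∈ minimalPrimes R, ringKrullDim (R ⧸ P) = ringKrullDim R

/-- The ideal `(x) ∩ (y₁, …, y_n)` in `K⟦x, y₁, …, y_n⟧`. -/
noncomputable def exIdeal (K : Type) [Field K] (n : ℕ) :
    Ideal (MvPowerSeries (Unit ⊕ Fin n) K) :=
  Ideal.span {MvPowerSeries.X (Sum.inl ())} ⊓
    Ideal.span (Set.range fun i : Fin n => MvPowerSeries.X (Sum.inr i))

/-- `T = K⟦x, y₁, …, y_n⟧/((x) ∩ (y₁, …, y_n))`. -/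
abbrev exRing (K : Type) [Field K] (n : ℕ) : Type :=
  MvPowerSeries (Unit ⊕ Fin n) K ⧸ exIdeal K n

/-- A local ring is Cohen-Macaulay if it has a regular sequence of length its dimension. -/
def IsCMLocal (R : Type) [CommRing R] [IsLocalRing R] : Prop :=
  ∃ rs : List R, (∀ r ∈ rs, r ∈ maximalIdeal R) ∧ RingTheory.Sequence.IsWeaklyRegular R rs ∧
    (rs.length : WithBot ℕ∞) = ringKrullDim R

section CM
open RingTheory.Sequence CategoryTheory Abelian Limits

theorem exists_isRegular_quotSMulTop {R : Type} [CommRing R] [IsLocalRing R] [IsNoetherianRing R]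
    {x : R} (hx : x ∈ maximalIdeal R) (hreg : IsSMulRegular R x) {n : ℕ} {rs : List R}
    (hmem : ∀ r ∈ rs, r ∈ maximalIdeal R) (hrs : IsRegular R rs) (hlen : rs.length = n + 1) :
    ∃ rs' : List R, rs'.length = n ∧ (∀ r ∈ rs', r ∈ maximalIdeal R) ∧
      IsRegular (QuotSMulTop x R) rs' := by
  have key : ∀ (M : Type) [AddCommGroup M] [Module R M] [Module.Finite R M] [Nontrivial M],
      maximalIdeal R • (⊤ : Submodule R M) < ⊤ := fun M _ _ _ _ =>
    (Submodule.top_ne_ideal_smul_of_le_jacobson_annihilator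
      (maximalIdeal_le_jacobson _)).symm.lt_top
  have : Nontrivial (QuotSMulTop x R) := nontrivial_quotSMulTop_of_mem_maximalIdeal R hx
  let N : ModuleCat.{0} R := ModuleCat.of R (R ⧸ maximalIdeal R)
  have hN : Module.support R N = PrimeSpectrum.zeroLocus (maximalIdeal R) := by
    rw [Module.support_eq_zeroLocus, Ideal.annihilator_quotient]
  have : Module.Finite R N := inferInstanceAs (Module.Finite R (R ⧸ maximalIdeal R))
  have hext := ModuleCat.subsingleton_ext_of_exists_isRegular (maximalIdeal R) N hN.le
    (ModuleCat.of R R) (key R) rs hmem hrs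
  refine ModuleCat.exists_isRegular_of_exists_subsingleton_ext (maximalIdeal R) n
    (ModuleCat.of R (QuotSMulTop x R)) (key _) N hN fun i hi => ?_
  have zero1 := AddCommGrpCat.isZero_of_iff_subsingleton.mpr (hext i (by omega))
  have zero2 := AddCommGrpCat.isZero_of_iff_subsingleton.mpr (hext (i + 1) (by omega))
  exact AddCommGrpCat.subsingleton_of_isZero <| ShortComplex.Exact.isZero_of_both_zeros
    ((Ext.covariant_sequence_exact₃' N
      (IsSMulRegular.smulShortComplex_shortExact (M := ModuleCat.of R R) hreg)) i (i + 1) rfl)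
    (zero1.eq_zero_of_src _) (zero2.eq_zero_of_tgt _)

/-- `R/xR` as the quotient ring and as the quotient module have the same regular sequences. -/
theorem isWeaklyRegular_quotient_span_iff {R : Type} [CommRing R] (x : R) (rs : List R) :
    IsWeaklyRegular (R ⧸ Ideal.span {x}) (rs.map (Ideal.Quotient.mk (Ideal.span {x}))) ↔
      IsWeaklyRegular (QuotSMulTop x R) rs := by
  rw [← Ideal.Quotient.algebraMap_eq, isWeaklyRegular_map_algebraMap_iff]
  refine LinearEquiv.isWeaklyRegular_congr (Submodule.quotEquivOfEq _ _ ?_) rs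
  rw [← Submodule.ideal_span_singleton_smul, smul_eq_mul, Ideal.mul_top]

variable {R : Type} [CommRing R] [IsLocalRing R]

instance quotient_span_isLocalRing {x : R} [Fact (x ∈ maximalIdeal R)] :
    IsLocalRing (R ⧸ Ideal.span {x}) := by
  have : Nontrivial (R ⧸ Ideal.span {x}) := Ideal.Quotient.nontrivial_iff.2 fun h =>
    (maximalIdeal.isMaximal R).ne_top
      (top_le_iff.1 (h ▸ (Ideal.span_singleton_le_iff_mem _).2 (Fact.out : x ∈ maximalIdeal R)))
  exact .of_surjective' _ Ideal.Quotient.mk_surjective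

theorem mk_mem_maximalIdeal_iff {I : Ideal R} [IsLocalRing (R ⧸ I)] {r : R} :
    Ideal.Quotient.mk I r ∈ maximalIdeal (R ⧸ I) ↔ r ∈ maximalIdeal R := by
  have := IsLocalHom.of_surjective (Ideal.Quotient.mk I) Ideal.Quotient.mk_surjective
  simp only [mem_maximalIdeal, mem_nonunits_iff, isUnit_map_iff]

theorem IsCMLocal.quotient [IsNoetherianRing R] {x : R} [hx : Fact (x ∈ maximalIdeal R)] (hreg : IsSMulRegular R x)
    (h : IsCMLocal R) : IsCMLocal (R ⧸ Ideal.span {x}) := by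
  obtain ⟨rs, hmem, hrs, hlen⟩ := h
  have hdim := ringKrullDim_quotient_span_singleton_succ_eq_ringKrullDim hreg hx.out
  rw [← hlen] at hdim
  obtain ⟨n, hn⟩ : ∃ n, rs.length = n + 1 := by
    cases hl : rs.length with
    | succ n => exact ⟨n, rfl⟩
    | zero =>
      exfalso
      rw [hl] at hdim
      have h0 : 0 ≤ ringKrullDim (R ⧸ Ideal.span {x}) := ringKrullDim_nonneg_of_nontrivial
      have h1 : (0 : WithBot ℕ∞) + 1 ≤ ringKrullDim (R ⧸ Ideal.span {x}) + 1 := by gcongr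
      rw [hdim] at h1
      exact absurd h1 (by simp only [Nat.cast_zero, zero_add, not_le]; exact zero_lt_one)
  obtain ⟨rs', hl', hm', hr'⟩ := exists_isRegular_quotSMulTop hx.out hreg hmem
    (.of_isWeaklyRegular_of_mem_maximalIdeal R hmem hrs) hn
  refine ⟨rs'.map (Ideal.Quotient.mk _), ?_,
    (isWeaklyRegular_quotient_span_iff x rs').2 hr'.toIsWeaklyRegular, ?_⟩
  · simp only [List.mem_map, forall_exists_index, and_imp, forall_apply_eq_imp_iff₂]
    exact fun a ha => mk_mem_maximalIdeal_iff.2 (hm' a ha)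
  · rw [List.length_map, hl']
    rw [hn, Nat.cast_add, Nat.cast_one] at hdim
    exact (ENat.WithBot.add_one_cancel.1 hdim).symm

theorem IsCMLocal.of_quotient [IsNoetherianRing R] {x : R} [hx : Fact (x ∈ maximalIdeal R)] (hreg : IsSMulRegular R x)
    (h : IsCMLocal (R ⧸ Ideal.span {x})) : IsCMLocal R := by
  obtain ⟨rs, hmem, hrs, hlen⟩ := h
  have hdim := ringKrullDim_quotient_span_singleton_succ_eq_ringKrullDim hreg hx.out
  obtain ⟨rs', rfl⟩ : ∃ rs' : List R, rs'.map (Ideal.Quotient.mk _) = rs :=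
    List.map_surjective_iff.2 Ideal.Quotient.mk_surjective rs
  refine ⟨x :: rs', ?_, (isWeaklyRegular_cons_iff R x rs').2
    ⟨hreg, (isWeaklyRegular_quotient_span_iff x rs').1 hrs⟩, ?_⟩
  · simp only [List.mem_cons, forall_eq_or_imp]
    exact ⟨hx.out, fun a ha => mk_mem_maximalIdeal_iff.1 (hmem _ (List.mem_map_of_mem ha))⟩
  · rw [← hdim, ← hlen]
    simp

theorem IsCMLocal.of_ringEquiv {S : Type} [CommRing S] [IsLocalRing S] (e : R ≃+* S)
    (h : IsCMLocal R) : IsCMLocal S := by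
  obtain ⟨rs, hmem, hrs, hlen⟩ := h
  refine ⟨rs.map e, ?_, ?_, ?_⟩
  · simp only [List.mem_map, forall_exists_index, and_imp, forall_apply_eq_imp_iff₂]
    intro a ha
    have := hmem a ha
    simpa [mem_maximalIdeal, mem_nonunits_iff] using this
  · refine (e.toAddEquiv.isWeaklyRegular_congr ?_).1 hrs
    exact List.forall₂_map_right_iff.mpr <| List.forall₂_same.mpr fun r _ x => by simp
  · rw [List.length_map, hlen, ringKrullDim_eq_of_ringEquiv e]

theorem IsCMLocal.of_isField (h : IsField R) : IsCMLocal R :=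
  ⟨[], by simp, by simp, by
    let _ := h.toField
    simp⟩

end CM

section AssChain
open RingTheory.Sequence

/-- Cutting by an `M`-regular element moves an associated prime of `M` strictly up to an
associated prime of `M/xM`. -/
theorem exists_lt_mem_associatedPrimes_quotSMulTop {R : Type} [CommRing R] [IsNoetherianRing R]
    {M : Type} [AddCommGroup M] [Module R M] [Module.Finite R M] {p q : PrimeSpectrum R}
    (hp : p.asIdeal ∈ associatedPrimes R M) (hpq : p ≤ q) {x : R} (hxq : x ∈ q.asIdeal)
    (hx : IsSMulRegular M x) :
    ∃ p' : PrimeSpectrum R, p < p' ∧ p' ≤ q ∧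
      p'.asIdeal ∈ associatedPrimes R (QuotSMulTop x M) := by
  rw [AssociatedPrimes.mem_iff, isAssociatedPrime_iff] at hp
  obtain ⟨hpp, m, hm⟩ := hp
  have hm' : ∀ r, r ∈ p.asIdeal ↔ r • m = 0 := fun r => by
    rw [hm, Submodule.mem_colon_singleton, Submodule.mem_bot]
  have hxp : x ∉ p.asIdeal := fun h => by
    have hm0 : m = 0 := hx (by simpa using (hm' x).1 h)
    exact hpp.ne_top ((Ideal.eq_top_iff_one _).2 ((hm' 1).2 (by simp [hm0])))
  let N : Submodule R M := Submodule.torsionBySet R M p.asIdeal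
  have hN : ∀ z, z ∈ N ↔ ∀ a ∈ p.asIdeal, a • z = 0 := fun z => by
    simp [N, Submodule.mem_torsionBySet_iff]
  have hann : Module.annihilator R N = p.asIdeal := by
    apply le_antisymm
    · intro r hr
      rw [Module.mem_annihilator] at hr
      exact (hm' r).2 (by simpa using congrArg Subtype.val (hr ⟨m, (hN m).2 fun a => (hm' a).1⟩))
    · intro r hr
      rw [Module.mem_annihilator]
      exact fun z => Subtype.ext ((hN z).1 z.2 r hr)
  have hinj : Function.Injective (QuotSMulTop.map x N.subtype) := by
    rw [← LinearMap.ker_eq_bot, LinearMap.ker_eq_bot']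
    intro z
    obtain ⟨z, rfl⟩ := Submodule.Quotient.mk_surjective _ z
    rw [QuotSMulTop.map_apply_mk, Submodule.Quotient.mk_eq_zero, Submodule.Quotient.mk_eq_zero,
      Submodule.mem_smul_pointwise_iff_exists]
    rintro ⟨w, -, hw⟩
    refine (Submodule.mem_smul_pointwise_iff_exists _ _ _).2 ⟨⟨w, (hN w).2 fun a ha => hx ?_⟩,
      trivial, Subtype.ext hw⟩
    have := (hN z).1 z.2 a ha
    simp only [smul_zero]
    rw [smul_comm, hw]
    exact this
  obtain ⟨p', hp'min, hp'q⟩ := Ideal.exists_minimalPrimes_le (I := p.asIdeal ⊔ Ideal.span {x})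
    (J := q.asIdeal) (sup_le hpq ((Ideal.span_singleton_le_iff_mem _).2 hxq))
  have hp'p := hp'min.1.1
  refine ⟨⟨p', hp'p⟩, ?_, hp'q, ?_⟩
  · refine lt_of_le_of_ne (le_sup_left.trans hp'min.1.2 : p.asIdeal ≤ p') fun h => hxp ?_
    rw [h]
    exact hp'min.1.2 (Ideal.mem_sup_right (Ideal.mem_span_singleton_self x))
  · refine associatedPrimes.subset_of_injective hinj
      (Module.associatedPrimes.minimalPrimes_annihilator_subset_associatedPrimes R _ ?_)
    have hsupp : PrimeSpectrum.zeroLocus (Module.annihilator R (QuotSMulTop x N) : Set R) =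
        PrimeSpectrum.zeroLocus (p.asIdeal ⊔ Ideal.span {x} : Ideal R) := by
      rw [← Module.support_eq_zeroLocus, Module.support_quotSMulTop, Module.support_eq_zeroLocus,
        hann, PrimeSpectrum.zeroLocus_sup, PrimeSpectrum.zeroLocus_span]
    rw [PrimeSpectrum.zeroLocus_eq_iff] at hsupp
    rw [← Ideal.radical_minimalPrimes, hsupp, Ideal.radical_minimalPrimes]
    exact hp'min

theorem height_add_length_le_of_mem_associatedPrimes {R : Type} [CommRing R] [IsNoetherianRing R]
    (rs : List R) {M : Type} [AddCommGroup M] [Module R M] [Module.Finite R M]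
    {p q : PrimeSpectrum R} (hp : p.asIdeal ∈ associatedPrimes R M) (hpq : p ≤ q)
    (hrs : IsWeaklyRegular M rs) (hmem : ∀ r ∈ rs, r ∈ q.asIdeal) :
    Order.height p + rs.length ≤ Order.height q := by
  induction rs generalizing M p with
  | nil => simpa using Order.height_mono hpq
  | cons x rs ih =>
    rw [isWeaklyRegular_cons_iff] at hrs
    simp only [List.mem_cons, forall_eq_or_imp] at hmem
    obtain ⟨p', hlt, hle, hass⟩ :=
      exists_lt_mem_associatedPrimes_quotSMulTop hp hpq hmem.1 hrs.1
    calc Order.height p + (x :: rs).length = Order.height p + 1 + rs.length := by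
          rw [List.length_cons]; push_cast; ring
      _ ≤ Order.height p' + rs.length := by gcongr; exact Order.height_add_one_le hlt
      _ ≤ _ := ih hass hle hrs.2 hmem.2

theorem length_le_one_of_mem_associatedPrimes_of_covBy {R : Type} [CommRing R] [IsNoetherianRing R]
    (rs : List R) {M : Type} [AddCommGroup M] [Module R M] [Module.Finite R M]
    {p q : PrimeSpectrum R} (hp : p.asIdeal ∈ associatedPrimes R M) (hpq : p ⋖ q)
    (hrs : IsWeaklyRegular M rs) (hmem : ∀ r ∈ rs, r ∈ q.asIdeal) :
    rs.length ≤ 1 := by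
  cases rs with
  | nil => simp
  | cons x rs =>
    rw [isWeaklyRegular_cons_iff] at hrs
    simp only [List.mem_cons, forall_eq_or_imp] at hmem
    obtain ⟨p', hlt, hle, hass⟩ :=
      exists_lt_mem_associatedPrimes_quotSMulTop hp hpq.le hmem.1 hrs.1
    obtain rfl : p' = q := hle.eq_of_not_lt (hpq.2 hlt)
    have := height_add_length_le_of_mem_associatedPrimes rs hass le_rfl hrs.2 hmem.2
    have hfin : Order.height p' ≠ ⊤ := by
      have := Ideal.height_ne_top p'.2.ne_top
      rwa [PrimeSpectrum.height_eq_orderHeight] at this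
    lift Order.height p' to ℕ using hfin with k
    norm_cast at this
    simp only [List.length_cons]
    omega

end AssChain

section Quot

/-- The order embedding `Spec (R/I) → Spec R`. -/
noncomputable def specQuotient {R : Type} [CommRing R] (I : Ideal R) :
    PrimeSpectrum (R ⧸ I) ↪o PrimeSpectrum R :=
  I.primeSpectrumQuotientOrderIsoZeroLocus.toOrderEmbedding.trans (OrderEmbedding.subtype _)

variable {R : Type} [CommRing R] {I : Ideal R}

theorem specQuotient_asIdeal (p : PrimeSpectrum (R ⧸ I)) :
    (specQuotient I p).asIdeal = p.asIdeal.comap (Ideal.Quotient.mk I) := rfl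

theorem le_specQuotient (p : PrimeSpectrum (R ⧸ I)) : I ≤ (specQuotient I p).asIdeal :=
  (I.primeSpectrumQuotientOrderIsoZeroLocus p).2

theorem exists_specQuotient_eq {p : PrimeSpectrum R} (hp : I ≤ p.asIdeal) :
    ∃ p', specQuotient I p' = p := by
  obtain ⟨p', hp'⟩ := I.primeSpectrumQuotientOrderIsoZeroLocus.surjective ⟨p, hp⟩
  exact ⟨p', congrArg Subtype.val hp'⟩

theorem map_specQuotient (p : PrimeSpectrum (R ⧸ I)) :
    (specQuotient I p).asIdeal.map (Ideal.Quotient.mk I) = p.asIdeal :=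
  Ideal.map_comap_of_surjective _ Ideal.Quotient.mk_surjective _

theorem height_specQuotient_le [IsNoetherianRing R] {x : R}
    (p : PrimeSpectrum (R ⧸ Ideal.span {x})) :
    Order.height (specQuotient _ p) ≤ Order.height p + 1 := by
  have h := Ideal.height_le_height_add_one_of_mem (p := (specQuotient _ p).asIdeal) (r := x)
    (le_specQuotient p (Ideal.mem_span_singleton_self x))
  rwa [map_specQuotient, PrimeSpectrum.height_eq_orderHeight,
    PrimeSpectrum.height_eq_orderHeight] at h

theorem height_add_one_le_height_specQuotient [IsNoetherianRing R] {x : R}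
    (hx : IsSMulRegular R x) (p : PrimeSpectrum (R ⧸ Ideal.span {x})) :
    Order.height p + 1 ≤ Order.height (specQuotient _ p) := by
  have hfin : Order.height p ≠ ⊤ := by
    have := Ideal.height_ne_top p.2.ne_top
    rwa [PrimeSpectrum.height_eq_orderHeight] at this
  obtain ⟨n, hn⟩ := ENat.ne_top_iff_exists.1 hfin
  obtain ⟨s, hs, hsl⟩ := Order.exists_series_of_le_height p hn.le
  let s' := s.map (specQuotient (Ideal.span {x})) (specQuotient _).strictMono
  obtain ⟨r, hrmin, hrle⟩ := Ideal.exists_minimalPrimes_le (I := ⊥) (J := s'.head.asIdeal) bot_le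
  have hx0 : x ∈ nonZeroDivisors R := by
    rw [mem_nonZeroDivisors_iff_right]
    exact fun y hy => hx (by simpa [mul_comm] using hy)
  have hxr : x ∉ r := fun h =>
    Set.disjoint_left.1 (Ideal.disjoint_nonZeroDivisors_of_mem_minimalPrimes hrmin) h hx0
  have hxs : x ∈ s'.head.asIdeal := le_specQuotient s.head (Ideal.mem_span_singleton_self x)
  let r' : PrimeSpectrum R := ⟨r, hrmin.1.1⟩
  have hlt : r' < s'.head := lt_of_le_of_ne hrle fun h => hxr (by
    rw [← h] at hxs; exact hxs)
  have := Order.length_le_height_last (p := RelSeries.cons s' r' hlt)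
  rw [RelSeries.last_cons] at this
  have hl : s'.last = specQuotient _ p := by rw [← hs]; rfl
  rw [hl, RelSeries.cons_length] at this
  rw [← hn, ← hsl]
  exact_mod_cast this

theorem exists_associatedPrime_of_forall_not_isSMulRegular [IsNoetherianRing R] (J : Ideal R)
    (h : ∀ x ∈ J, ¬ IsSMulRegular R x) : ∃ P ∈ associatedPrimes R R, J ≤ P := by
  have hsub : (J : Set R) ⊆ ⋃ P ∈ associatedPrimes R R, (P : Set R) := by
    rw [biUnion_associatedPrimes_eq_compl_regular]
    exact h
  exact (Ideal.subset_union_prime_finite (associatedPrimes.finite R R) (f := fun P => P) ⊥ ⊥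
    (fun P hP _ _ => hP.isPrime)).1 hsub

variable [IsLocalRing R] [IsNoetherianRing R]

theorem IsCMLocal.height_eq_zero (h : IsCMLocal R) {P : PrimeSpectrum R}
    (hP : P.asIdeal ∈ associatedPrimes R R) : Order.height P = 0 := by
  obtain ⟨rs, hmem, hrs, hlen⟩ := h
  let m : PrimeSpectrum R := ⟨maximalIdeal R, inferInstance⟩
  have := height_add_length_le_of_mem_associatedPrimes rs hP
    (q := m) (le_maximalIdeal P.2.ne_top) hrs hmem
  rw [← maximalIdeal_height_eq_ringKrullDim] at hlen
  have hm : (maximalIdeal R).height = Order.height m := PrimeSpectrum.height_eq_orderHeight m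
  rw [← hm, ← (WithBot.coe_injective (a₁ := (rs.length : ℕ∞)) hlen)] at this
  have hfin : Order.height P ≠ ⊤ := by
    have := Ideal.height_ne_top P.2.ne_top
    rwa [PrimeSpectrum.height_eq_orderHeight] at this
  obtain ⟨n, hn⟩ := ENat.ne_top_iff_exists.1 hfin
  rw [← hn] at this ⊢
  norm_cast at this ⊢
  omega

theorem ringKrullDim_quotient_span_singleton_lt {x : R} (hx : x ∈ maximalIdeal R)
    (hreg : IsSMulRegular R x) {d : ℕ} (hd : ringKrullDim R < (d + 1 : ℕ)) :
    ringKrullDim (R ⧸ Ideal.span {x}) < d := by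
  rw [← ringKrullDim_quotient_span_singleton_succ_eq_ringKrullDim hreg hx, Nat.cast_add,
    Nat.cast_one] at hd
  exact ENat.WithBot.add_one_le_natCast_iff.1 (ENat.WithBot.lt_add_one_iff.1 hd)

theorem not_ringKrullDim_lt_zero {R : Type} [CommRing R] [IsLocalRing R] : ¬ ringKrullDim R < (0 : ℕ) := by
  simpa using (ringKrullDim_nonneg_of_nontrivial (R := R))

end Quot

/-- In a Cohen-Macaulay local ring every prime contains a regular sequence of length its height. -/
theorem IsCMLocal.exists_height_le_length (d : ℕ) : ∀ {R : Type} [CommRing R] [IsLocalRing R]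
    [IsNoetherianRing R], ringKrullDim R < d → IsCMLocal R → ∀ q : PrimeSpectrum R,
    ∃ rs : List R, (∀ r ∈ rs, r ∈ q.asIdeal) ∧ RingTheory.Sequence.IsWeaklyRegular R rs ∧
      Order.height q ≤ rs.length := by
  induction d with
  | zero => exact fun h => absurd h not_ringKrullDim_lt_zero
  | succ d ih =>
    intro R _ _ _ hd hCM q
    by_cases hq : ∃ x ∈ q.asIdeal, IsSMulRegular R x
    · obtain ⟨x, hxq, hx⟩ := hq
      have hxm : x ∈ maximalIdeal R := le_maximalIdeal q.2.ne_top hxq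
      have : Fact (x ∈ maximalIdeal R) := ⟨hxm⟩
      obtain ⟨q', rfl⟩ := exists_specQuotient_eq ((Ideal.span_singleton_le_iff_mem _).2 hxq)
      obtain ⟨rs, hmem, hrs, hlen⟩ :=
        ih (ringKrullDim_quotient_span_singleton_lt hxm hx hd) (hCM.quotient hx) q'
      obtain ⟨rs', rfl⟩ : ∃ rs' : List R, rs'.map (Ideal.Quotient.mk _) = rs :=
        List.map_surjective_iff.2 Ideal.Quotient.mk_surjective rs
      refine ⟨x :: rs', ?_, (RingTheory.Sequence.isWeaklyRegular_cons_iff R x rs').2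
        ⟨hx, (isWeaklyRegular_quotient_span_iff x rs').1 hrs⟩, ?_⟩
      · simp only [List.mem_cons, forall_eq_or_imp]
        exact ⟨hxq, fun a ha => hmem _ (List.mem_map_of_mem ha)⟩
      · refine (height_specQuotient_le q').trans ?_
        rw [List.length_cons, Nat.cast_add, Nat.cast_one, ← List.length_map]
        gcongr
    · push Not at hq
      obtain ⟨P, hP, hle⟩ := exists_associatedPrime_of_forall_not_isSMulRegular q.asIdeal hq
      have h0 := hCM.height_eq_zero (P := ⟨P, hP.isPrime⟩) hP
      refine ⟨[], by simp, by simp, ?_⟩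
      simpa [h0] using Order.height_mono (show q ≤ ⟨P, hP.isPrime⟩ from hle)

theorem IsCMLocal.height_le_of_covBy_aux (d : ℕ) : ∀ {R : Type} [CommRing R] [IsLocalRing R]
    [IsNoetherianRing R], ringKrullDim R < d → IsCMLocal R → ∀ {p q : PrimeSpectrum R}, p ⋖ q →
    Order.height q ≤ Order.height p + 1 := by
  induction d with
  | zero => exact fun h => absurd h not_ringKrullDim_lt_zero
  | succ d ih =>
    intro R _ _ _ hd hCM p q hpq
    by_cases hp : ∃ x ∈ p.asIdeal, IsSMulRegular R x
    · obtain ⟨x, hxp, hx⟩ := hp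
      have hxm : x ∈ maximalIdeal R := le_maximalIdeal p.2.ne_top hxp
      have : Fact (x ∈ maximalIdeal R) := ⟨hxm⟩
      obtain ⟨p', rfl⟩ := exists_specQuotient_eq ((Ideal.span_singleton_le_iff_mem _).2 hxp)
      obtain ⟨q', rfl⟩ := exists_specQuotient_eq
        ((Ideal.span_singleton_le_iff_mem _).2 (hpq.le hxp))
      have h := ih (ringKrullDim_quotient_span_singleton_lt hxm hx hd) (hCM.quotient hx)
        (CovBy.of_image _ hpq)
      calc _ ≤ _ := height_specQuotient_le q'
        _ ≤ Order.height p' + 1 + 1 := by gcongr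
        _ ≤ _ := by gcongr; exact height_add_one_le_height_specQuotient hx p'
    · push Not at hp
      obtain ⟨P, hP, hle⟩ := exists_associatedPrime_of_forall_not_isSMulRegular p.asIdeal hp
      have h0 := hCM.height_eq_zero (P := ⟨P, hP.isPrime⟩) hP
      have hpP : p = ⟨P, hP.isPrime⟩ := by
        rw [Order.height_eq_zero] at h0
        exact le_antisymm hle (h0 hle)
      obtain ⟨rs, hmem, hrs, hlen⟩ := IsCMLocal.exists_height_le_length (d + 1) hd hCM q
      refine hlen.trans ?_
      have := length_le_one_of_mem_associatedPrimes_of_covBy rs (M := R) (p := p)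
        (by rw [hpP]; exact hP) hpq hrs hmem
      calc (rs.length : ℕ∞) ≤ (1 : ℕ) := by exact_mod_cast this
        _ ≤ _ := by simp

/-- Covering relations in the spectrum of a Cohen-Macaulay local ring increase heights by at most
one. -/
theorem IsCMLocal.height_le_of_covBy {R : Type} [CommRing R] [IsLocalRing R]
    [IsNoetherianRing R] (hCM : IsCMLocal R) {p q : PrimeSpectrum R} (hpq : p ⋖ q) :
    Order.height q ≤ Order.height p + 1 := by
  obtain ⟨rs, -, -, hlen⟩ := id hCM
  refine IsCMLocal.height_le_of_covBy_aux (rs.length + 1) ?_ hCM hpq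
  rw [← hlen]
  exact_mod_cast Nat.lt_succ_self _

section PowerSeriesRings

theorem PowerSeries.X_mem_maximalIdeal {R : Type} [CommRing R] [IsLocalRing R] :
    (PowerSeries.X : PowerSeries R) ∈ maximalIdeal (PowerSeries R) := by
  rw [mem_maximalIdeal, mem_nonunits_iff]
  exact fun h => not_isUnit_zero (M₀ := R) (by simpa using h.map (PowerSeries.constantCoeff (R := R)))

theorem PowerSeries.isSMulRegular_X {R : Type} [CommRing R] :
    IsSMulRegular (PowerSeries R) (PowerSeries.X : PowerSeries R) := fun _ _ h =>
  PowerSeries.X_mul_cancel h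

theorem PowerSeries.ker_constantCoeff {R : Type} [CommRing R] :
    RingHom.ker (PowerSeries.constantCoeff (R := R)) = Ideal.span {PowerSeries.X} := by
  ext f
  rw [RingHom.mem_ker, Ideal.mem_span_singleton, PowerSeries.X_dvd_iff]

noncomputable def PowerSeries.quotientXEquiv (R : Type) [CommRing R] :
    (PowerSeries R ⧸ Ideal.span {(PowerSeries.X : PowerSeries R)}) ≃+* R :=
  (Ideal.quotEquivOfEq PowerSeries.ker_constantCoeff.symm).trans
    (RingHom.quotientKerEquivOfSurjective PowerSeries.constantCoeff_surj)

theorem PowerSeries.ringKrullDim_eq_add_one (R : Type) [CommRing R] [IsLocalRing R]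
    [IsNoetherianRing R] : ringKrullDim (PowerSeries R) = ringKrullDim R + 1 := by
  rw [← ringKrullDim_quotient_span_singleton_succ_eq_ringKrullDim
    PowerSeries.isSMulRegular_X PowerSeries.X_mem_maximalIdeal,
    ringKrullDim_eq_of_ringEquiv (PowerSeries.quotientXEquiv R)]

theorem PowerSeries.isCMLocal {R : Type} [CommRing R] [IsLocalRing R]
    [IsNoetherianRing R] (h : IsCMLocal R) : IsCMLocal (PowerSeries R) := by
  have : Fact ((PowerSeries.X : PowerSeries R) ∈ maximalIdeal (PowerSeries R)) :=
    ⟨PowerSeries.X_mem_maximalIdeal⟩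
  exact .of_quotient PowerSeries.isSMulRegular_X (h.of_ringEquiv (PowerSeries.quotientXEquiv R).symm)

variable (K : Type) [Field K]

theorem MvPowerSeries.isCMLocal_fin (n : ℕ) : IsCMLocal (MvPowerSeries (Fin n) K) := by
  induction n with
  | zero =>
    exact (IsCMLocal.of_isField (Field.toIsField K)).of_ringEquiv
      (MvPowerSeries.isEmptyEquiv (Fin 0) K).symm.toRingEquiv
  | succ n ih =>
    exact (PowerSeries.isCMLocal ih).of_ringEquiv (MvPowerSeries.finSuccEquiv K n).symm.toRingEquiv

theorem MvPowerSeries.ringKrullDim_fin (n : ℕ) :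
    ringKrullDim (MvPowerSeries (Fin n) K) = n := by
  induction n with
  | zero =>
    rw [ringKrullDim_eq_of_ringEquiv (MvPowerSeries.isEmptyEquiv (Fin 0) K).toRingEquiv]
    simp
  | succ n ih =>
    rw [ringKrullDim_eq_of_ringEquiv (MvPowerSeries.finSuccEquiv K n).toRingEquiv,
      PowerSeries.ringKrullDim_eq_add_one, ih]
    simp

theorem PowerSeries.ringKrullDim_field : ringKrullDim (PowerSeries K) = 1 := by
  rw [PowerSeries.ringKrullDim_eq_add_one]
  simp

theorem MvPowerSeries.mem_span_range_X_fin (n : ℕ) (g : MvPowerSeries (Fin n) K)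
    (hg : MvPowerSeries.constantCoeff g = 0) :
    g ∈ Ideal.span (Set.range (MvPowerSeries.X : Fin n → MvPowerSeries (Fin n) K)) := by
  induction n with
  | zero =>
    have : g = 0 := by
      ext d
      rw [Subsingleton.elim d 0, MvPowerSeries.coeff_zero_eq_constantCoeff_apply, hg, map_zero]
    rw [this]
    exact zero_mem _
  | succ n ih =>
    let e := MvPowerSeries.finSuccEquiv K n
    have h0 : MvPowerSeries.constantCoeff (PowerSeries.constantCoeff (e g)) = 0 := by
      rw [← MvPowerSeries.coeff_zero_eq_constantCoeff_apply,
        ← PowerSeries.coeff_zero_eq_constantCoeff_apply,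
        MvPowerSeries.coeff_coeff_finSuccEquiv, ← hg,
        ← MvPowerSeries.coeff_zero_eq_constantCoeff_apply]
      congr 2
      ext i
      refine Fin.cases ?_ (fun i => ?_) i <;> simp
    have h1 := ih _ h0
    have h2 : g = e.symm (PowerSeries.C (PowerSeries.constantCoeff (e g))) +
        MvPowerSeries.X 0 * e.symm (PowerSeries.mk fun p => PowerSeries.coeff (p + 1) (e g)) := by
      apply e.injective
      rw [map_add, map_mul, e.apply_symm_apply, e.apply_symm_apply,
        MvPowerSeries.finSuccEquiv_X_zero]
      exact (PowerSeries.eq_X_mul_shift_add_const (e g)).trans (add_comm _ _)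
    rw [h2]
    refine add_mem ?_ (Ideal.mul_mem_right _ _ (Ideal.subset_span ⟨0, rfl⟩))
    have h3 := Ideal.mem_map_of_mem (e.symm.toRingHom.comp PowerSeries.C) h1
    rw [Ideal.map_span] at h3
    refine Ideal.span_le.2 ?_ h3
    rintro _ ⟨_, ⟨i, rfl⟩, rfl⟩
    refine Ideal.subset_span ⟨i.succ, ?_⟩
    apply e.injective
    rw [MvPowerSeries.finSuccEquiv_X_succ]
    exact (e.apply_symm_apply _).symm

theorem MvPowerSeries.mem_span_range_X {σ : Type} [Fintype σ] (g : MvPowerSeries σ K)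
    (hg : MvPowerSeries.constantCoeff g = 0) :
    g ∈ Ideal.span (Set.range (MvPowerSeries.X : σ → MvPowerSeries σ K)) := by
  let e := MvPowerSeries.renameEquiv K (Fintype.equivFin σ)
  have h0 : MvPowerSeries.constantCoeff (e g) = 0 := by
    by_contra h
    have h1 : IsUnit (e g) := MvPowerSeries.isUnit_iff_constantCoeff.2 (isUnit_iff_ne_zero.2 h)
    rw [MulEquiv.isUnit_map, MvPowerSeries.isUnit_iff_constantCoeff, hg] at h1
    exact not_isUnit_zero h1
  have h3 := Ideal.mem_map_of_mem e.symm.toRingHom (MvPowerSeries.mem_span_range_X_fin K _ _ h0)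
  rw [Ideal.map_span] at h3
  have h4 : e.symm.toRingHom (e g) = g := e.symm_apply_apply g
  rw [h4] at h3
  refine Ideal.span_le.2 ?_ h3
  rintro _ ⟨_, ⟨i, rfl⟩, rfl⟩
  refine Ideal.subset_span ⟨(Fintype.equivFin σ).symm i, ?_⟩
  apply e.injective
  exact (MvPowerSeries.rename_X _ _).trans ((congrArg _ (by simp)).trans
    (e.apply_symm_apply _).symm)

end PowerSeriesRings

section ExampleRing

variable (K : Type) [Field K] (n : ℕ)

/-- `K⟦x, y₁, …, y_n⟧ ≃ K⟦y₁, …, y_n⟧⟦x⟧`. -/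
noncomputable def exEquiv :
    MvPowerSeries (Unit ⊕ Fin n) K ≃+* PowerSeries (MvPowerSeries (Fin n) K) :=
  ((MvPowerSeries.renameEquiv K ((Equiv.sumComm _ _).trans
    (Equiv.optionEquivSumPUnit (Fin n)).symm)).trans
      (MvPowerSeries.optionEquivLeft (Fin n) K)).toRingEquiv

theorem exEquiv_X_inl : exEquiv K n (MvPowerSeries.X (Sum.inl ())) = PowerSeries.X := by
  refine (congrArg (MvPowerSeries.optionEquivLeft (Fin n) K) (MvPowerSeries.rename_X _ _)).trans ?_
  exact MvPowerSeries.optionEquivLeft_X_none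

theorem exEquiv_X_inr (i : Fin n) :
    exEquiv K n (MvPowerSeries.X (Sum.inr i)) = PowerSeries.C (MvPowerSeries.X i) := by
  refine (congrArg (MvPowerSeries.optionEquivLeft (Fin n) K) (MvPowerSeries.rename_X _ _)).trans ?_
  exact MvPowerSeries.optionEquivLeft_X_some i

/-- The quotient map with kernel `(x)`. -/
noncomputable def exProj₁ : MvPowerSeries (Unit ⊕ Fin n) K →+* MvPowerSeries (Fin n) K :=
  PowerSeries.constantCoeff.comp (exEquiv K n).toRingHom

/-- The quotient map with kernel `(y₁, …, y_n)`. -/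
noncomputable def exProj₂ : MvPowerSeries (Unit ⊕ Fin n) K →+* PowerSeries K :=
  (PowerSeries.map MvPowerSeries.constantCoeff).comp (exEquiv K n).toRingHom

theorem exProj₁_surjective : Function.Surjective (exProj₁ K n) :=
  PowerSeries.constantCoeff_surj.comp (exEquiv K n).surjective

theorem exProj₂_surjective : Function.Surjective (exProj₂ K n) :=
  (PowerSeries.map_surjective _ fun a => ⟨MvPowerSeries.C a, MvPowerSeries.constantCoeff_C a⟩).comp (exEquiv K n).surjective

theorem ker_exProj₁ :
    RingHom.ker (exProj₁ K n) = Ideal.span {MvPowerSeries.X (Sum.inl ())} := by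
  have : RingHom.ker (exProj₁ K n) =
      (RingHom.ker (PowerSeries.constantCoeff (R := MvPowerSeries (Fin n) K))).comap
        (exEquiv K n) := rfl
  rw [this, PowerSeries.ker_constantCoeff, ← exEquiv_X_inl]
  ext f
  rw [Ideal.mem_comap, Ideal.mem_span_singleton, Ideal.mem_span_singleton, map_dvd_iff]

theorem ker_exProj₂ :
    RingHom.ker (exProj₂ K n) =
      Ideal.span (Set.range fun i : Fin n => MvPowerSeries.X (Sum.inr i)) := by
  apply le_antisymm
  · intro f hf
    have h0 : ∀ k, ∃ c : Fin n → MvPowerSeries (Fin n) K,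
        ∑ i, c i * MvPowerSeries.X i = PowerSeries.coeff k (exEquiv K n f) := by
      intro k
      refine Ideal.mem_span_range_iff_exists_fun.1 (MvPowerSeries.mem_span_range_X_fin K n _ ?_)
      have h1 := congrArg (PowerSeries.coeff k) ((RingHom.mem_ker).1 hf)
      rw [map_zero] at h1
      exact (PowerSeries.coeff_map _ _ _).symm.trans h1
    choose c hc using h0
    rw [Ideal.mem_span_range_iff_exists_fun]
    refine ⟨fun i => (exEquiv K n).symm (PowerSeries.mk fun k => c k i), ?_⟩
    apply (exEquiv K n).injective
    simp only [map_sum, map_mul, RingEquiv.apply_symm_apply, exEquiv_X_inr]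
    ext1 k
    simp [← hc]
  · rw [Ideal.span_le]
    rintro _ ⟨i, rfl⟩
    change PowerSeries.map MvPowerSeries.constantCoeff (exEquiv K n _) = 0
    rw [exEquiv_X_inr, PowerSeries.map_C, MvPowerSeries.constantCoeff_X, map_zero]

/-- The image of `(x)` in `T`. -/
noncomputable abbrev exP₁ : Ideal (exRing K n) :=
  Ideal.map (Ideal.Quotient.mk (exIdeal K n)) (Ideal.span {MvPowerSeries.X (Sum.inl ())})

/-- The image of `(y₁, …, y_n)` in `T`. -/
noncomputable abbrev exP₂ : Ideal (exRing K n) :=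
  Ideal.map (Ideal.Quotient.mk (exIdeal K n))
    (Ideal.span (Set.range fun i : Fin n => MvPowerSeries.X (Sum.inr i)))

noncomputable def exQuotEquiv₁ : (exRing K n ⧸ exP₁ K n) ≃+* MvPowerSeries (Fin n) K :=
  (DoubleQuot.quotQuotEquivQuotOfLE inf_le_left).trans <|
    (Ideal.quotEquivOfEq (ker_exProj₁ K n).symm).trans
    (RingHom.quotientKerEquivOfSurjective (exProj₁_surjective K n))

noncomputable def exQuotEquiv₂ : (exRing K n ⧸ exP₂ K n) ≃+* PowerSeries K :=
  (DoubleQuot.quotQuotEquivQuotOfLE inf_le_right).trans <|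
    (Ideal.quotEquivOfEq (ker_exProj₂ K n).symm).trans
    (RingHom.quotientKerEquivOfSurjective (exProj₂_surjective K n))

instance exP₁_isPrime : (exP₁ K n).IsPrime := by
  have : IsDomain (MvPowerSeries (Fin n) K) := NoZeroDivisors.to_isDomain _
  have := (exQuotEquiv₁ K n).toMulEquiv.isDomain
  exact (Ideal.Quotient.isDomain_iff_prime _).1 this

instance exP₂_isPrime : (exP₂ K n).IsPrime := by
  have := (exQuotEquiv₂ K n).toMulEquiv.isDomain
  exact (Ideal.Quotient.isDomain_iff_prime _).1 this

variable {K n} in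
theorem mk_mem_exP₁ {f : MvPowerSeries (Unit ⊕ Fin n) K} :
    Ideal.Quotient.mk (exIdeal K n) f ∈ exP₁ K n ↔
      f ∈ Ideal.span {MvPowerSeries.X (Sum.inl ())} :=
  Ideal.mem_quotient_iff_mem inf_le_left

variable {K n} in
theorem mk_mem_exP₂ {f : MvPowerSeries (Unit ⊕ Fin n) K} :
    Ideal.Quotient.mk (exIdeal K n) f ∈ exP₂ K n ↔
      f ∈ Ideal.span (Set.range fun i : Fin n => MvPowerSeries.X (Sum.inr i)) :=
  Ideal.mem_quotient_iff_mem inf_le_right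

theorem exP₁_inf_exP₂ : exP₁ K n ⊓ exP₂ K n = ⊥ := by
  rw [eq_bot_iff]
  rintro t ⟨h1, h2⟩
  obtain ⟨f, rfl⟩ := Ideal.Quotient.mk_surjective t
  rw [SetLike.mem_coe, mk_mem_exP₁] at h1
  rw [SetLike.mem_coe, mk_mem_exP₂] at h2
  exact Ideal.Quotient.eq_zero_iff_mem.2 ⟨h1, h2⟩

theorem ringKrullDim_quotient_exP₁ : ringKrullDim (exRing K n ⧸ exP₁ K n) = n := by
  rw [ringKrullDim_eq_of_ringEquiv (exQuotEquiv₁ K n), MvPowerSeries.ringKrullDim_fin]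

theorem ringKrullDim_quotient_exP₂ : ringKrullDim (exRing K n ⧸ exP₂ K n) = 1 := by
  rw [ringKrullDim_eq_of_ringEquiv (exQuotEquiv₂ K n), PowerSeries.ringKrullDim_field]

theorem not_exP₁_le_exP₂ : ¬ exP₁ K n ≤ exP₂ K n := by
  intro h
  have h1 : Ideal.Quotient.mk (exIdeal K n) (MvPowerSeries.X (Sum.inl ())) ∈ exP₂ K n :=
    h (Ideal.mem_map_of_mem _ (Ideal.mem_span_singleton_self _))
  rw [mk_mem_exP₂, ← ker_exProj₂, RingHom.mem_ker] at h1
  change PowerSeries.map MvPowerSeries.constantCoeff (exEquiv K n _) = 0 at h1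
  rw [exEquiv_X_inl, PowerSeries.map_X] at h1
  exact PowerSeries.X_ne_zero h1

theorem not_exP₂_le_exP₁ (hn : 0 < n) : ¬ exP₂ K n ≤ exP₁ K n := by
  intro h
  have h1 : Ideal.Quotient.mk (exIdeal K n) (MvPowerSeries.X (Sum.inr ⟨0, hn⟩)) ∈ exP₁ K n :=
    h (Ideal.mem_map_of_mem _ (Ideal.subset_span ⟨⟨0, hn⟩, rfl⟩))
  rw [mk_mem_exP₁, ← ker_exProj₁, RingHom.mem_ker] at h1
  change PowerSeries.constantCoeff (exEquiv K n _) = 0 at h1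
  rw [exEquiv_X_inr, PowerSeries.constantCoeff_C] at h1
  have := congrArg (MvPowerSeries.coeff (Finsupp.single ⟨0, hn⟩ 1)) h1
  simp at this

theorem exRing_mem_sup (t : exRing K n) (ht : ¬ IsUnit t) : t ∈ exP₁ K n ⊔ exP₂ K n := by
  obtain ⟨f, rfl⟩ := Ideal.Quotient.mk_surjective t
  have hf : ¬ IsUnit f := fun h => ht (h.map _)
  rw [MvPowerSeries.isUnit_iff_constantCoeff, isUnit_iff_ne_zero, not_not] at hf
  rw [← Ideal.map_sup]
  refine Ideal.mem_map_of_mem _ (Ideal.span_le.2 ?_ (MvPowerSeries.mem_span_range_X K f hf))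
  rintro _ ⟨i | i, rfl⟩
  · exact Ideal.mem_sup_left (Ideal.subset_span rfl)
  · exact Ideal.mem_sup_right (Ideal.subset_span ⟨i, rfl⟩)

end ExampleRing

theorem minimalPrimes_eq_pair {R : Type*} [CommRing R] {P₁ P₂ : Ideal R} [P₁.IsPrime] [P₂.IsPrime]
    (h : P₁ ⊓ P₂ = ⊥) (h₁₂ : ¬ P₁ ≤ P₂) (h₂₁ : ¬ P₂ ≤ P₁) : minimalPrimes R = {P₁, P₂} := by
  have key : ∀ Q : Ideal R, Q.IsPrime → P₁ ≤ Q ∨ P₂ ≤ Q := fun Q hQ =>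
    (hQ.inf_le).mp (h.trans_le bot_le)
  ext Q
  simp only [minimalPrimes_eq_minimals, Set.mem_ofPred_eq, Set.mem_insert_iff,
    Set.mem_singleton_iff]
  constructor
  · intro hQ
    rcases key Q hQ.prop with h | h
    · exact .inl (hQ.eq_of_le ‹_› h).symm
    · exact .inr (hQ.eq_of_le ‹_› h).symm
  · rintro (rfl | rfl)
    · refine ⟨‹_›, fun J hJ hle => ?_⟩
      rcases key J hJ with h | h
      · exact h
      · exact (h₂₁ (h.trans hle)).elim
    · refine ⟨‹_›, fun J hJ hle => ?_⟩
      rcases key J hJ with h | h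
      · exact (h₁₂ (h.trans hle)).elim
      · exact h

section ExampleRing

variable (K : Type) [Field K] (n : ℕ)

theorem minimalPrimes_exRing (hn : 0 < n) :
    minimalPrimes (exRing K n) = {exP₁ K n, exP₂ K n} :=
  minimalPrimes_eq_pair (exP₁_inf_exP₂ K n) (not_exP₁_le_exP₂ K n) (not_exP₂_le_exP₁ K n hn)

theorem not_isEquidimensional_exRing (hn : 1 < n) : ¬ IsEquidimensional (exRing K n) := by
  intro h
  have hmin := minimalPrimes_exRing K n (by omega)
  have h₁ := h (exP₁ K n) (by simp [hmin])
  have h₂ := h (exP₂ K n) (by simp [hmin])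
  rw [ringKrullDim_quotient_exP₁] at h₁
  rw [ringKrullDim_quotient_exP₂, ← h₁] at h₂
  have : n = 1 := by exact_mod_cast h₂.symm
  omega

end ExampleRing

theorem covBy_of_mem_minimalPrimes_sup {R : Type} [CommRing R] [IsNoetherianRing R] {I : Ideal R}
    {x : R} {p q : PrimeSpectrum R} (hp : I ≤ p.asIdeal)
    (hq : q.asIdeal ∈ (I ⊔ Ideal.span {x}).minimalPrimes) (hpq : p < q) : p ⋖ q := by
  refine ⟨hpq, fun r hpr hrq => ?_⟩
  obtain ⟨p', rfl⟩ := exists_specQuotient_eq hp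
  obtain ⟨r', rfl⟩ := exists_specQuotient_eq (hp.trans hpr.le)
  obtain ⟨q', rfl⟩ := exists_specQuotient_eq (le_sup_left.trans hq.1.2)
  have h := Ideal.map_height_le_one_of_mem_minimalPrimes hq
  rw [map_specQuotient, PrimeSpectrum.height_eq_orderHeight] at h
  have h₁ := Order.height_add_one_le ((specQuotient I).lt_iff_lt.mp hpr)
  have h₂ := Order.height_add_one_le ((specQuotient I).lt_iff_lt.mp hrq)
  have h₃ : (2 : ℕ∞) ≤ 1 := calc
    (2 : ℕ∞) = 0 + 1 + 1 := by norm_num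
    _ ≤ Order.height p' + 1 + 1 := by gcongr; exact zero_le
    _ ≤ Order.height r' + 1 := by gcongr
    _ ≤ 1 := h₂.trans h
  exact absurd h₃ (by norm_num)

/-- A local ring whose spectrum is the union of two closed irreducible sets `V(P₁)` and `V(P₂)`,
meeting transversally in the closed point, with `R ⧸ P₁` Cohen–Macaulay of dimension at least two
and `R ⧸ P₂` of dimension one. -/
structure IsTwoBranched {R : Type} [CommRing R] [IsLocalRing R] (P₁ P₂ : Ideal R) : Prop where
  isPrime₁ : P₁.IsPrime
  isPrime₂ : P₂.IsPrime
  inf_eq : P₁ ⊓ P₂ = ⊥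
  le_sup : maximalIdeal R ≤ P₁ ⊔ P₂
  not_le₁ : ¬ P₁ ≤ P₂
  not_le₂ : ¬ P₂ ≤ P₁
  isCMLocal : ∀ [IsLocalRing (R ⧸ P₁)], IsCMLocal (R ⧸ P₁)
  two_le_dim : 2 ≤ ringKrullDim (R ⧸ P₁)
  dim_le_one : ringKrullDim (R ⧸ P₂) ≤ 1

namespace IsTwoBranched

variable {R : Type} [CommRing R] [IsLocalRing R] {P₁ P₂ : Ideal R}

theorem mul_eq_zero (h : IsTwoBranched P₁ P₂) {u v : R} (hu : u ∈ P₁) (hv : v ∈ P₂) : u * v = 0 := by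
  have : u * v ∈ P₁ ⊓ P₂ := ⟨P₁.mul_mem_right _ hu, P₂.mul_mem_left _ hv⟩
  rwa [h.inf_eq] at this

theorem eq_zero (h : IsTwoBranched P₁ P₂) {u : R} (h₁ : u ∈ P₁) (h₂ : u ∈ P₂) : u = 0 := by
  have : u ∈ P₁ ⊓ P₂ := ⟨h₁, h₂⟩
  rwa [h.inf_eq] at this

theorem le_or_le (h : IsTwoBranched P₁ P₂) (p : PrimeSpectrum R) : P₁ ≤ p.asIdeal ∨ P₂ ≤ p.asIdeal :=
  p.2.inf_le.mp (h.inf_eq.trans_le bot_le)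

theorem eq_or_isMax (h : IsTwoBranched P₁ P₂) {p : PrimeSpectrum R} (hp : P₂ ≤ p.asIdeal) :
    p.asIdeal = P₂ ∨ p.asIdeal.IsMaximal := by
  have := h.isPrime₂
  obtain ⟨p', rfl⟩ := exists_specQuotient_eq hp
  have hd : Ring.KrullDimLE 1 (R ⧸ P₂) := Ring.krullDimLE_iff.mpr h.dim_le_one
  rcases Ring.krullDimLE_one_iff.mp hd p'.asIdeal p'.2 with h' | h'
  · rw [IsDomain.minimalPrimes_eq_singleton_bot, Set.mem_singleton_iff] at h'
    left
    rw [specQuotient_asIdeal, h', ← RingHom.ker_eq_comap_bot, Ideal.mk_ker]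
  · right
    rw [specQuotient_asIdeal]
    exact Ideal.comap_isMaximal_of_surjective _ Ideal.Quotient.mk_surjective

theorem length_le_one (h : IsTwoBranched P₁ P₂) {s : LTSeries (PrimeSpectrum R)} (hs : P₂ ≤ s.head.asIdeal) :
    s.length ≤ 1 := by
  by_contra! hl
  have hmono := s.strictMono
  have h₁ : s ⟨0, by omega⟩ < s ⟨1, by omega⟩ := hmono (by simp [Fin.lt_def])
  have h₂ : s ⟨1, by omega⟩ < s ⟨2, by omega⟩ := hmono (by simp [Fin.lt_def])
  rcases h.eq_or_isMax (p := s ⟨1, by omega⟩) (hs.trans h₁.le) with h' | h'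
  · exact not_le_of_gt h₁ (h'.trans_le hs)
  · exact h₂.ne (PrimeSpectrum.ext (h'.eq_of_le (s ⟨2, by omega⟩).2.ne_top h₂.le))

theorem height_le_of_covBy (h : IsTwoBranched P₁ P₂) [IsNoetherianRing R] {p q : PrimeSpectrum R} (hpq : p ⋖ q)
    (hp : ¬ P₂ ≤ p.asIdeal) : Order.height q ≤ Order.height p + 1 := by
  have := h.isPrime₁
  have hp₁ : P₁ ≤ p.asIdeal := (h.le_or_le p).resolve_right hp
  have : IsLocalRing (R ⧸ P₁) :=
    IsLocalRing.of_surjective' (Ideal.Quotient.mk P₁) Ideal.Quotient.mk_surjective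
  obtain ⟨p', rfl⟩ := exists_specQuotient_eq hp₁
  obtain ⟨q', rfl⟩ := exists_specQuotient_eq (hp₁.trans hpq.1.le)
  have hcov : p' ⋖ q' := CovBy.of_image (specQuotient P₁) hpq
  have hle : Order.height q' ≤ Order.height (specQuotient P₁ p') + 1 :=
    (h.isCMLocal.height_le_of_covBy hcov).trans (by
      gcongr
      exact Order.height_le_height_apply_of_strictMono _ (specQuotient P₁).strictMono _)
  refine Order.height_le fun s hs => ?_
  rcases h.le_or_le s.head with h' | h'
  · have hi : ∀ i, ∃ r, specQuotient P₁ r = s i := fun i =>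
      exists_specQuotient_eq (h'.trans (s.strictMono.monotone (Fin.zero_le i)))
    choose g hg using hi
    have hg' : StrictMono g := fun i j hij => by
      rw [← (specQuotient P₁).lt_iff_lt, hg, hg]
      exact s.strictMono hij
    have hlast : (LTSeries.mk s.length g hg').last = q' := (specQuotient P₁).injective <| by
      rw [← hs]
      exact hg _
    refine le_trans ?_ hle
    rw [← hlast]
    exact Order.length_le_height_last (p := LTSeries.mk s.length g hg')
  · exact (Nat.cast_le.mpr (h.length_le_one h')).trans (by simp)

end IsTwoBranched

theorem isCatenary_of_height_le {A : Type} [CommRing A] [IsNoetherianRing A]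
    (h : ∀ p q : PrimeSpectrum A, p ⋖ q → Order.height q ≤ Order.height p + 1) :
    IsCatenary A := by
  have hfin : ∀ p : PrimeSpectrum A, Order.height p ≠ ⊤ := fun p => by
    rw [← PrimeSpectrum.height_eq_orderHeight]
    exact Ideal.height_ne_top p.2.ne_top
  have heq : ∀ p q : PrimeSpectrum A, p ⋖ q → Order.height q = Order.height p + 1 := fun p q hpq =>
    (h p q hpq).antisymm (Order.height_add_one_le hpq.1)
  have key : ∀ (n : ℕ) (f : Fin (n + 1) → PrimeSpectrum A), IsSaturatedChain f →
      Order.height (f (Fin.last n)) = Order.height (f 0) + n := by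
    intro n f hf
    suffices ∀ i : Fin (n + 1), Order.height (f i) = Order.height (f 0) + (i : ℕ) by
      simpa using this (Fin.last n)
    intro i
    induction i using Fin.induction with
    | zero => simp
    | succ i ih =>
      rw [heq _ _ (hf i), ih]
      simp [add_assoc]
  intro n m f g hf hg h₀ h₁
  have := (key n f hf).symm.trans ((congrArg Order.height h₁).trans (key m g hg))
  rw [h₀] at this
  exact_mod_cast ENat.add_right_injective_of_ne_top (hfin (g 0)) this

theorem Ideal.LiesOver.of_mem_minimalPrimes_map {A T : Type} [CommRing A] [CommRing T] [Algebra A T]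
    [Algebra.HasGoingDown A T] {p : Ideal A} [p.IsPrime] {q : Ideal T}
    (hq : q ∈ (p.map (algebraMap A T)).minimalPrimes) : q.LiesOver p := by
  have := hq.1.1
  have hle : p ≤ q.under A := Ideal.le_comap_of_map_le hq.1.2
  obtain ⟨r, hrq, hr, hrp⟩ := Ideal.exists_ideal_le_liesOver_of_le (p := p) (q := q.under A) q hle
  have : q ≤ r := hq.2 ⟨hr, Ideal.map_le_iff_le_comap.mpr hrp.over.le⟩ hrq
  rwa [this.antisymm hrq]

theorem Ideal.height_eq_of_mem_minimalPrimes_map {A T : Type} [CommRing A] [CommRing T]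
    [IsNoetherianRing A] [IsNoetherianRing T] [Algebra A T]
    [Algebra.HasGoingDown A T] {p : Ideal A} [p.IsPrime] {q : Ideal T}
    (hq : q ∈ (p.map (algebraMap A T)).minimalPrimes) : q.height = p.height := by
  have := hq.1.1
  have := Ideal.LiesOver.of_mem_minimalPrimes_map hq
  rw [Ideal.height_eq_height_add_of_liesOver_of_hasGoingDown p q]
  have : (q.map (Ideal.Quotient.mk (p.map (algebraMap A T)))) ∈
      minimalPrimes (T ⧸ p.map (algebraMap A T)) := by
    have := Ideal.minimalPrimes_eq_comap (I := p.map (algebraMap A T))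
    rw [this] at hq
    obtain ⟨r, hr, rfl⟩ := hq
    rwa [Ideal.map_comap_of_surjective _ Ideal.Quotient.mk_surjective]
  have hp := this.1.1
  rw [show (q.map (Ideal.Quotient.mk (p.map (algebraMap A T)))).height = 0 from
    Ideal.height_eq_zero_iff.mpr this, add_zero]

section

variable {A T : Type} [CommRing A] [IsDomain A] [CommRing T] [IsLocalRing T] [Algebra A T]
  [Module.Flat A T] {P₁ P₂ : Ideal T}

theorem IsTwoBranched.algebraMap_notMem₁ (h : IsTwoBranched P₁ P₂) {d : A} (hd : d ≠ 0) :
    algebraMap A T d ∉ P₁ := by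
  intro hmem
  refine h.not_le₂ fun v hv => ?_
  have h0 : d • v = d • 0 := by
    rw [smul_zero, Algebra.smul_def, h.mul_eq_zero hmem hv]
  have : IsSMulRegular T d := (Module.Flat.isSMulRegular_of_isRegular (IsRegular.of_ne_zero hd))
  rw [this h0]
  exact P₁.zero_mem

theorem IsTwoBranched.algebraMap_notMem₂ (h : IsTwoBranched P₁ P₂) {d : A} (hd : d ≠ 0) :
    algebraMap A T d ∉ P₂ := by
  intro hmem
  refine h.not_le₁ fun u hu => ?_
  have h0 : d • u = d • 0 := by
    rw [smul_zero, Algebra.smul_def, mul_comm, h.mul_eq_zero hu hmem]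
  have : IsSMulRegular T d := (Module.Flat.isSMulRegular_of_isRegular (IsRegular.of_ne_zero hd))
  rw [this h0]
  exact P₂.zero_mem

theorem IsTwoBranched.height_le_of_covBy_base [IsLocalRing A]
    [IsNoetherianRing A] [IsNoetherianRing T] [IsLocalHom (algebraMap A T)]
    (h : IsTwoBranched P₁ P₂) {p q : PrimeSpectrum A} (hpq : p ⋖ q) :
    Order.height q ≤ Order.height p + 1 := by
  have hff : Module.FaithfullyFlat A T := Module.FaithfullyFlat.of_flat_of_isLocalHom
  by_cases hp : p.asIdeal = ⊥
  · refine Order.height_le fun s hs => ?_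
    by_contra! hl
    have hl' : 1 < s.length := by
      have : (1 : ℕ∞) < s.length := lt_of_le_of_lt (by simp) hl
      exact_mod_cast this
    have h₁ : s ⟨0, by omega⟩ < s ⟨s.length - 1, by omega⟩ :=
      s.strictMono (by simp [Fin.lt_def]; omega)
    have h₂ : s ⟨s.length - 1, by omega⟩ < q := by
      rw [← hs]
      exact s.strictMono (by simp [Fin.lt_def, Fin.last]; omega)
    have h₀ : p ≤ s ⟨0, by omega⟩ := by
      change p.asIdeal ≤ _
      rw [hp]
      exact bot_le
    exact hpq.2 (h₀.trans_lt h₁) h₂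
  obtain ⟨d, hdp, hd⟩ := Submodule.exists_mem_ne_zero_of_ne_bot hp
  obtain ⟨c, hcq, hcp⟩ := SetLike.exists_of_lt (show p.asIdeal < q.asIdeal from hpq.1)
  obtain ⟨Q', hQ', hQ'q⟩ := q.asIdeal.exists_isPrime_liesOver_of_faithfullyFlat (B := T)
  have hle : q.asIdeal.map (algebraMap A T) ≤ Q' := Ideal.map_le_iff_le_comap.mpr hQ'q.over.le
  obtain ⟨Q, hQ, -⟩ := Ideal.exists_minimalPrimes_le hle
  have hQprime := hQ.1.1
  have hQq := Ideal.LiesOver.of_mem_minimalPrimes_map hQ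
  obtain ⟨P', hP'Q, hP', hP'p⟩ :=
    Ideal.exists_ideal_le_liesOver_of_le (p := p.asIdeal) (q := q.asIdeal) Q hpq.1.le
  obtain ⟨P, hP, hPP'⟩ := Ideal.exists_minimalPrimes_le
    (show p.asIdeal.map (algebraMap A T) ≤ P' from Ideal.map_le_iff_le_comap.mpr hP'p.over.le)
  have hPprime := hP.1.1
  have hPp := Ideal.LiesOver.of_mem_minimalPrimes_map hP
  have hPQ : P < Q := by
    refine lt_of_le_of_ne (hPP'.trans hP'Q) ?_
    rintro rfl
    exact hpq.1.ne (PrimeSpectrum.ext (hPp.over.trans hQq.over.symm))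
  have hQmin : Q ∈ (p.asIdeal.map (algebraMap A T) ⊔
      Ideal.span {algebraMap A T c}).minimalPrimes := by
    refine ⟨⟨hQprime, sup_le (hP.1.2.trans hPQ.le) ?_⟩, ?_⟩
    · rw [Ideal.span_singleton_le_iff_mem]
      exact hQ.1.2 (Ideal.mem_map_of_mem _ hcq)
    · rintro r ⟨hr, hrle⟩ hrQ
      refine hQ.2 ⟨hr, ?_⟩ hrQ
      rw [Ideal.map_le_iff_le_comap]
      let r' : PrimeSpectrum A := ⟨r.comap (algebraMap A T), inferInstance⟩
      have hpr : p < r' := by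
        refine lt_of_le_of_ne (Ideal.map_le_iff_le_comap.mp (le_sup_left.trans hrle)) ?_
        rintro heq
        apply hcp
        rw [heq]
        exact hrle (Ideal.mem_sup_right (Ideal.mem_span_singleton_self _))
      have hrq : r' ≤ q := by
        change r.comap (algebraMap A T) ≤ q.asIdeal
        rw [hQq.over]
        exact Ideal.comap_mono hrQ
      exact (eq_of_le_of_not_lt hrq (hpq.2 hpr)).ge
  have hcov : (⟨P, hPprime⟩ : PrimeSpectrum T) ⋖ ⟨Q, hQprime⟩ :=
    covBy_of_mem_minimalPrimes_sup hP.1.2 hQmin hPQ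
  have hdP : algebraMap A T d ∈ P := hP.1.2 (Ideal.mem_map_of_mem _ hdp)
  have hPP₂ : ¬ P₂ ≤ P := fun hle => by
    rcases h.eq_or_isMax (p := ⟨P, hPprime⟩) hle with h' | h'
    · exact h.algebraMap_notMem₂ hd (h' ▸ hdP)
    · exact hPQ.ne (h'.eq_of_le hQprime.ne_top hPQ.le)
  have hfinal := h.height_le_of_covBy hcov hPP₂
  rwa [← PrimeSpectrum.height_eq_orderHeight, ← PrimeSpectrum.height_eq_orderHeight,
    Ideal.height_eq_of_mem_minimalPrimes_map hQ, Ideal.height_eq_of_mem_minimalPrimes_map hP,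
    PrimeSpectrum.height_eq_orderHeight, PrimeSpectrum.height_eq_orderHeight] at hfinal

end

theorem Module.Flat.mem_map_colon {A T : Type} [CommRing A] [CommRing T] [Algebra A T]
    [Module.Flat A T] {I : Ideal A} (hI : I.FG) {a : A} {u : T}
    (h : ∀ c ∈ I, ∃ t, algebraMap A T c * u = algebraMap A T a * t) :
    ∃ J : Ideal A, (∀ b ∈ J, ∀ c ∈ I, a ∣ c * b) ∧ u ∈ J.map (algebraMap A T) := by
  obtain ⟨r, x, hx⟩ := Submodule.fg_iff_exists_fin_generating_family.mp hI
  have hxI : ∀ i, x i ∈ I := fun i => by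
    rw [← hx]
    exact Submodule.subset_span ⟨i, rfl⟩
  choose w hw using fun i => h (x i) (hxI i)
  let f : (Fin r → A) →ₗ[A] A × (Fin r → A) :=
    (Fintype.linearCombination A x).prod (a • LinearMap.id)
  let g : A × (Fin r → A) →ₗ[A] T :=
    (LinearMap.toSpanSingleton A T u).coprod (-Fintype.linearCombination A w)
  have hgf : g ∘ₗ f = 0 := by
    ext i
    simp [f, g, Fintype.linearCombination_apply, Pi.single_apply, Algebra.smul_def, hw, apply_ite (algebraMap A T)]
  obtain ⟨k, y, z, hz, hy⟩ := Module.Flat.exists_factorization_of_comp_eq_zero_of_free hgf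
  refine ⟨Ideal.span (Set.range (y (1, 0))), ?_, ?_⟩
  · intro b hb c hc
    have : ∀ i j, a ∣ x i * y (1, 0) j := fun i j => by
      have h₁ := DFunLike.congr (LinearMap.congr_fun hy (Pi.single i 1)) (rfl : j = j)
      have h₂ : f (Pi.single i 1) = x i • (1, 0) + a • (0, Pi.single i 1) := by
        ext <;> simp [f, Fintype.linearCombination_apply, Pi.single_apply]
      rw [LinearMap.comp_apply, h₂, map_add, map_smul, map_smul] at h₁
      simp at h₁
      exact ⟨-y (0, Pi.single i 1) j, by linear_combination h₁⟩
    have hle : I * Ideal.span (Set.range (y (1, 0))) ≤ Ideal.span {a} := by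
      rw [← hx]
      change Ideal.span _ * _ ≤ _
      rw [Ideal.span_mul_span', Ideal.span_le]
      rintro _ ⟨_, ⟨i, rfl⟩, _, ⟨j, rfl⟩, rfl⟩
      exact Ideal.mem_span_singleton.mpr (this i j)
    exact Ideal.mem_span_singleton.mp (hle (Ideal.mul_mem_mul hc hb))
  · have hu : g (1, 0) = u := by simp [g]
    have hw' : ∀ w : Fin k →₀ A, (∀ j, w j ∈ Ideal.span (Set.range (y (1, 0)))) →
        z w ∈ (Ideal.span (Set.range (y (1, 0)))).map (algebraMap A T) := by
      intro w hw
      rw [← Finsupp.sum_single w, Finsupp.sum, map_sum]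
      refine Ideal.sum_mem _ fun j _ => ?_
      rw [← mul_one (w j), ← smul_eq_mul, ← Finsupp.smul_single, map_smul, Algebra.smul_def]
      exact Ideal.mul_mem_right _ _ (Ideal.mem_map_of_mem _ (hw j))
    rw [← hu, hz]
    exact hw' _ fun j => Ideal.subset_span ⟨j, rfl⟩

/-- Elements `a`, `b` of a local ring such that `b / a` is integral and lifts a nontrivial idempotent
of the residue ring, while multiplication by `b / a` preserves the maximal ideal. -/
structure IsBranchPair {A : Type} [CommRing A] [IsLocalRing A] (a b : A) : Prop where
  ne_zero : a ≠ 0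
  not_dvd : ¬ a ∣ b
  sq : ∃ g ∈ maximalIdeal A, b ^ 2 - a * b = a ^ 2 * g
  mul : ∀ c ∈ maximalIdeal A, ∃ c' ∈ maximalIdeal A, c * b = a * c'
  exists_pow : ∀ d ≠ 0, ∃ M : ℕ, ∀ c ∈ maximalIdeal A ^ M, ∃ c' ∈
    Ideal.span {d} ⊔ maximalIdeal A ^ (M + 1), c * b = a * c'

theorem IsTwoBranched.exists_isBranchPair {A T : Type} [CommRing A] [IsDomain A] [IsLocalRing A]
    [IsNoetherianRing A] [CommRing T] [IsLocalRing T] [IsNoetherianRing T] [Algebra A T]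
    [Module.Flat A T] [IsLocalHom (algebraMap A T)] {P₁ P₂ : Ideal T}
    (h : IsTwoBranched P₁ P₂) (hmap : (maximalIdeal A).map (algebraMap A T) = maximalIdeal T)
    (hres : ∀ t : T, ∃ c : A, t - algebraMap A T c ∈ maximalIdeal T) {a : A} (ha : a ≠ 0)
    (ham : a ∈ maximalIdeal A) : ∃ b, IsBranchPair a b := by
  have hff : Module.FaithfullyFlat A T := Module.FaithfullyFlat.of_flat_of_isLocalHom
  have hprime₁ := h.isPrime₁
  have hprime₂ := h.isPrime₂
  have hcancel : ∀ {s t : T}, algebraMap A T a * s = algebraMap A T a * t → s = t := by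
    intro s t hst
    have : IsSMulRegular T a := Module.Flat.isSMulRegular_of_isRegular (IsRegular.of_ne_zero ha)
    exact this (by simpa [Algebra.smul_def] using hst)
  have hcomap : ∀ I : Ideal A, ∀ c, algebraMap A T c ∈ I.map (algebraMap A T) → c ∈ I := by
    intro I c hc
    rw [← Ideal.comap_map_eq_self_of_faithfullyFlat (B := T) I]
    exact hc
  have hmem : ∀ c, algebraMap A T c ∈ maximalIdeal T ↔ c ∈ maximalIdeal A := fun c =>
    ⟨fun hc => hcomap _ _ (hmap ▸ hc), fun hc => hmap ▸ Ideal.mem_map_of_mem _ hc⟩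
  have hdvd : ∀ c d : A, algebraMap A T c ∣ algebraMap A T d → c ∣ d := by
    intro c d hcd
    rw [← Ideal.mem_span_singleton]
    apply hcomap
    rwa [Ideal.map_span, Set.image_singleton, Ideal.mem_span_singleton]
  have hsplit : ∀ t ∈ maximalIdeal T, ∃ p ∈ P₁, ∃ q ∈ P₂, p + q = t := fun t ht =>
    Submodule.mem_sup.mp (h.le_sup ht)
  obtain ⟨u, hu, v, hv, huv⟩ := hsplit _ ((hmem a).mpr ham)
  have hmulu : ∀ p ∈ P₁, ∀ q ∈ P₂, (p + q) * u = algebraMap A T a * p := by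
    intro p hp q hq
    rw [← huv]
    linear_combination h.mul_eq_zero hu hq - h.mul_eq_zero hp hv
  have hndvd : ¬ algebraMap A T a ∣ u := by
    rintro ⟨t, ht⟩
    have h₀ : u * (1 - t) = v * t := by rw [← huv] at ht; linear_combination ht
    have h₁ : u * (1 - t) = 0 := h.eq_zero (P₁.mul_mem_right _ hu) (h₀ ▸ P₂.mul_mem_right _ hv)
    rcases IsLocalRing.isUnit_or_isUnit_one_sub_self t with ht | ht
    · have : v = 0 := (ht.mul_left_eq_zero).mp (h₀.symm.trans h₁)
      refine h.algebraMap_notMem₁ ha ?_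
      rwa [← huv, this, add_zero]
    · have : u = 0 := (ht.mul_left_eq_zero).mp h₁
      refine h.algebraMap_notMem₂ ha ?_
      rwa [← huv, this, zero_add]
  obtain ⟨J, hJ, huJ⟩ := Module.Flat.mem_map_colon (maximalIdeal A).fg_of_isNoetherianRing
    (a := a) (u := u) fun c hc => by
      obtain ⟨p, hp, q, hq, hpq⟩ := hsplit _ ((hmem c).mpr hc)
      exact ⟨p, by rw [← hpq, hmulu p hp q hq]⟩
  have hJT : ∀ b ∈ J, ∀ t ∈ maximalIdeal T, algebraMap A T a ∣ t * algebraMap A T b := by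
    intro b hb t ht
    rw [← Ideal.mem_span_singleton]
    have hle : maximalIdeal A * J ≤ Ideal.span {a} := Ideal.mul_le.mpr fun c hc b hb =>
      Ideal.mem_span_singleton.mpr (hJ b hb c hc)
    have := Ideal.map_mono (f := algebraMap A T) hle
    rw [Ideal.map_mul, hmap, Ideal.map_span, Set.image_singleton] at this
    exact this (Ideal.mul_mem_mul ht (Ideal.mem_map_of_mem _ hb))
  obtain ⟨b₀, hb₀, t₀, hb₀u⟩ : ∃ b₀ ∈ J, ∃ t₀, u = algebraMap A T b₀ + algebraMap A T a * t₀ := by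
    refine Submodule.span_induction ?_ ?_ ?_ ?_ huJ
    · rintro _ ⟨b, hb, rfl⟩
      exact ⟨b, hb, 0, by simp⟩
    · exact ⟨0, J.zero_mem, 0, by simp⟩
    · rintro _ _ _ _ ⟨b, hb, t, rfl⟩ ⟨b', hb', t', rfl⟩
      exact ⟨b + b', J.add_mem hb hb', t + t', by simp; ring⟩
    · rintro w _ _ ⟨b, hb, t, rfl⟩
      obtain ⟨c, hc⟩ := hres w
      obtain ⟨t', ht'⟩ := hJT b hb _ hc
      refine ⟨c * b, J.mul_mem_left _ hb, t' + w * t, ?_⟩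
      rw [smul_eq_mul, map_mul]
      linear_combination ht'
  obtain ⟨c₀, hc₀⟩ := hres (-t₀)
  set s := -t₀ - algebraMap A T c₀ with hs
  have hb : algebraMap A T (b₀ - a * c₀) = u + algebraMap A T a * s := by
    rw [hs, map_sub, map_mul]
    linear_combination -hb₀u
  have hbm : ∀ c ∈ maximalIdeal A, a ∣ c * (b₀ - a * c₀) := fun c hc => by
    rw [mul_sub]
    exact dvd_sub (hJ b₀ hb₀ c hc) ⟨c * c₀, by ring⟩
  generalize b₀ - a * c₀ = b at hb hbm
  have hc' : ∀ c c' : A, c * b = a * c' → ∀ p : T, algebraMap A T c * u = algebraMap A T a * p →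
      algebraMap A T c' = p + algebraMap A T c * s := by
    intro c c' hcc' p hp
    apply hcancel
    rw [← map_mul, ← hcc', map_mul, hb]
    linear_combination hp
  refine ⟨b, ha, ?_, ?_, ?_, ?_⟩
  · rintro ⟨e, rfl⟩
    refine hndvd ⟨algebraMap A T e - s, ?_⟩
    rw [map_mul] at hb
    linear_combination -hb
  · obtain ⟨p, hp, q, hq, hpq⟩ := hsplit s hc₀
    have hsu : s * u = algebraMap A T a * p := by rw [← hpq, hmulu p hp q hq]
    have hau : algebraMap A T a * u = u ^ 2 := by
      rw [← huv]
      linear_combination h.mul_eq_zero hu hv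
    have hT : algebraMap A T (b ^ 2 - a * b) = algebraMap A T (a ^ 2) * (2 * p + s ^ 2 - s) := by
      simp only [map_sub, map_mul, map_pow, hb]
      linear_combination -hau + 2 * algebraMap A T a * hsu
    obtain ⟨g, hg⟩ := hdvd (a ^ 2) (b ^ 2 - a * b) ⟨_, hT⟩
    refine ⟨g, ?_, hg⟩
    rw [← hmem]
    have : algebraMap A T g = 2 * p + s ^ 2 - s := by
      apply hcancel
      apply hcancel
      rw [hg] at hT
      simp only [map_mul, map_pow] at hT
      linear_combination hT
    rw [this]
    refine sub_mem (add_mem (Ideal.mul_mem_left _ _ (le_maximalIdeal h.isPrime₁.ne_top hp)) ?_) hc₀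
    exact Ideal.pow_mem_of_mem _ hc₀ 2 two_pos
  · intro c hc
    obtain ⟨c', hcc'⟩ := hbm c hc
    refine ⟨c', ?_, hcc'⟩
    obtain ⟨p, hp, q, hq, hpq⟩ := hsplit _ ((hmem c).mpr hc)
    rw [← hmem, hc' c c' hcc' p (by rw [← hpq, hmulu p hp q hq])]
    exact add_mem (le_maximalIdeal h.isPrime₁.ne_top hp) (Ideal.mul_mem_left _ _ hc₀)
  · intro d hd
    have hrad : maximalIdeal T ≤ (P₂ ⊔ Ideal.span {algebraMap A T d}).radical := by
      rw [Ideal.radical_eq_sInf]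
      refine le_sInf fun Q ⟨hQ, hQp⟩ => ?_
      rcases h.eq_or_isMax (p := ⟨Q, hQp⟩) (le_sup_left.trans hQ) with h' | h'
      · refine (h.algebraMap_notMem₂ hd ?_).elim
        rw [← h']
        exact hQ (Ideal.mem_sup_right (Ideal.mem_span_singleton_self _))
      · exact (eq_maximalIdeal h').ge
    obtain ⟨N, hN⟩ := Ideal.exists_pow_le_of_le_radical_of_fg hrad
      (maximalIdeal T).fg_of_isNoetherianRing
    refine ⟨N + 1, fun c hc => ?_⟩
    obtain ⟨c', hcc'⟩ := hbm c (Ideal.pow_le_self (by omega) hc)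
    refine ⟨c', ?_, hcc'⟩
    have hcT : algebraMap A T c ∈ maximalIdeal T ^ (N + 1) := by
      rw [← hmap, ← Ideal.map_pow]
      exact Ideal.mem_map_of_mem _ hc
    have hcT' := Ideal.mul_mono_left (K := maximalIdeal T) hN (pow_succ (maximalIdeal T) N ▸ hcT)
    rw [Ideal.sup_mul] at hcT'
    obtain ⟨y, hy, z, hz, hyz⟩ := Submodule.mem_sup.mp hcT'
    obtain ⟨t, ht, rfl⟩ := Ideal.mem_span_singleton_mul.mp hz
    obtain ⟨p, hp, q, hq, hpq⟩ := hsplit t ht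
    have hcu : algebraMap A T c * u = algebraMap A T a * (algebraMap A T d * p) := by
      rw [← hyz, ← hpq]
      linear_combination h.mul_eq_zero hu (Ideal.mul_le_left hy) +
        algebraMap A T d * hmulu p hp q hq
    apply hcomap
    rw [hc' c c' hcc' _ hcu, Ideal.map_sup, Ideal.map_span, Set.image_singleton, Ideal.map_pow,
      hmap, pow_succ]
    exact add_mem (Ideal.mem_sup_left (Ideal.mul_mem_right _ _ (Ideal.mem_span_singleton_self _)))
      (Ideal.mem_sup_right (Ideal.mul_mem_mul hcT hc₀))

theorem IsCatenary.of_ringEquiv {R S : Type} [CommRing R] [CommRing S] (e : R ≃+* S)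
    (h : IsCatenary R) : IsCatenary S := by
  intro n m f g hf hg h₀ h₁
  let E := (PrimeSpectrum.comapEquiv e).symm
  exact h n m (E ∘ f) (E ∘ g) (fun i => (apply_covBy_apply_iff E).mpr (hf i))
    (fun i => (apply_covBy_apply_iff E).mpr (hg i)) (congrArg E h₀) (congrArg E h₁)

theorem exists_isSaturatedChain_of_height_eq {R : Type} [CommRing R] [IsDomain R]
    {p : PrimeSpectrum R} {n : ℕ} (hp : Order.height p = n) :
    ∃ f : Fin (n + 1) → PrimeSpectrum R, IsSaturatedChain f ∧ f 0 = ⊥ ∧ f (Fin.last n) = p := by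
  obtain ⟨s, rfl, rfl⟩ := Order.exists_series_of_height_eq_coe p hp
  have hs := Order.height_eq_index_of_length_eq_height_last hp.symm
  refine ⟨s, fun i => ⟨s.strictMono i.castSucc_lt_succ, fun r h₁ h₂ => ?_⟩, ?_, rfl⟩
  · have hr : Order.height r < ⊤ :=
      (Order.height_mono h₂.le).trans_lt (by rw [hs]; exact ENat.natCast_lt_top _)
    have h₁' := Order.height_add_one_le h₁
    have h₂' := Order.height_strictMono h₂ hr
    rw [hs] at h₁' h₂'
    exact absurd h₂' (not_lt.mpr (by simpa using h₁'))
  · have := hs 0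
    simpa using this

theorem IsCatenary.height_le_two {R : Type} [CommRing R] [IsDomain R] [IsNoetherianRing R]
    (h : IsCatenary R) {p q : PrimeSpectrum R} (hp : ⊥ ⋖ p) (hq : p ⋖ q) :
    Order.height q ≤ 2 := by
  have hfin : Order.height q ≠ ⊤ := by
    rw [← PrimeSpectrum.height_eq_orderHeight]
    exact Ideal.height_ne_top q.2.ne_top
  obtain ⟨n, hn⟩ := ENat.ne_top_iff_exists.mp hfin
  obtain ⟨f, hf, hf₀, hf₁⟩ := exists_isSaturatedChain_of_height_eq hn.symm
  have := h n 2 f ![⊥, p, q] hf (fun i => by fin_cases i <;> assumption) (by simpa) (by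
    rw [hf₁]
    rfl)
  rw [← hn, this]
  rfl

section

open Polynomial

variable {A : Type} [CommRing A]

theorem Polynomial.exists_C_pow_mul_sub_C_mem_span (a b : A) (h : A[X]) :
    ∃ (k : ℕ) (c : A), C a ^ k * h - C c ∈ Ideal.span {C a * X - C b} := by
  induction h using Polynomial.induction_on with
  | C c => exact ⟨0, c, by simp⟩
  | add p q hp hq =>
    obtain ⟨k, c, hc⟩ := hp
    obtain ⟨l, d, hd⟩ := hq
    refine ⟨k + l, a ^ l * c + a ^ k * d, ?_⟩
    have := add_mem (Ideal.mul_mem_left _ (C a ^ l) hc) (Ideal.mul_mem_left _ (C a ^ k) hd)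
    convert this using 1
    simp only [map_add, map_mul, map_pow]
    ring
  | monomial n e ih =>
    obtain ⟨k, c, hc⟩ := ih
    refine ⟨k + 1, c * b, ?_⟩
    have := add_mem (Ideal.mul_mem_left _ (C a * X) hc)
      (Ideal.mul_mem_left _ (C c) (Ideal.mem_span_singleton_self (C a * X - C b)))
    convert this using 1
    simp only [map_mul]
    ring

variable [IsDomain A] [IsLocalRing A] [IsNoetherianRing A]

theorem IsBranchPair.not_isCatenary_polynomial {a b : A} (h : IsBranchPair a b)
    (ham : a ∈ maximalIdeal A) (hdim : 2 ≤ (maximalIdeal A).height) : ¬ IsCatenary A[X] := by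
  intro hcat
  let φ : A[X] →+* FractionRing A := (aeval (algebraMap A (FractionRing A) b / algebraMap A (FractionRing A) a)).toRingHom
  have hinj : Function.Injective (algebraMap A (FractionRing A)) := IsFractionRing.injective A (FractionRing A)
  have ha0 : algebraMap A (FractionRing A) a ≠ 0 := fun h0 => h.ne_zero (hinj (by rw [h0, map_zero]))
  have hφC : ∀ c, φ (C c) = algebraMap A (FractionRing A) c := fun c => by simp [φ]
  have hφX : φ X = algebraMap A (FractionRing A) b / algebraMap A (FractionRing A) a := by simp [φ]
  let P : PrimeSpectrum A[X] := ⟨RingHom.ker φ, RingHom.ker_isPrime φ⟩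
  have hP : ∀ f, f ∈ P.asIdeal ↔ φ f = 0 := fun f => RingHom.mem_ker
  have hCP : ∀ c, C c ∈ P.asIdeal → c = 0 := fun c hc => by
    rw [hP, hφC] at hc
    exact hinj (by rw [hc, map_zero])
  have hlin : ∀ c c' : A, c * b = a * c' → C c * X - C c' ∈ P.asIdeal := fun c c' hcc => by
    have := congrArg (algebraMap A (FractionRing A)) hcc
    simp only [map_mul] at this
    rw [hP, map_sub, map_mul, hφC, hφC, hφX]
    field_simp
    linear_combination this
  obtain ⟨g, hg, hbg⟩ := h.sq
  have hquad : X ^ 2 - X - C g ∈ P.asIdeal := by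
    have := congrArg (algebraMap A (FractionRing A)) hbg
    simp only [map_mul, map_sub, map_pow] at this
    rw [hP, map_sub, map_sub, map_pow, hφC, hφX]
    field_simp
    linear_combination this
  have hNmax : ((maximalIdeal A).comap (evalRingHom 1)).IsMaximal :=
    Ideal.comap_isMaximal_of_surjective _ fun c => ⟨C c, by simp⟩
  let N : PrimeSpectrum A[X] := ⟨(maximalIdeal A).comap (evalRingHom 1), hNmax.isPrime⟩
  have hN : ∀ f, f ∈ N.asIdeal ↔ f.eval 1 ∈ maximalIdeal A := fun f => Iff.rfl
  have hPN : P ≤ N := by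
    intro f hf
    have hmonic : (X ^ 2 - X - C g : A[X]).Monic := by monicity!
    have hdeg : (f %ₘ (X ^ 2 - X - C g)).degree ≤ 1 := by
      have hlt := degree_modByMonic_lt f hmonic
      rw [show (X ^ 2 - X - C g : A[X]).degree = 2 by compute_degree!] at hlt
      exact Order.le_of_lt_succ hlt
    have hmod := modByMonic_add_div f (X ^ 2 - X - C g)
    obtain ⟨r, s, hrs⟩ : ∃ r s : A, f %ₘ (X ^ 2 - X - C g) = C r * X + C s :=
      ⟨_, _, eq_X_add_C_of_degree_le_one hdeg⟩
    rw [hrs] at hmod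
    have hrsP : C r * X + C s ∈ P.asIdeal := by
      rw [← hmod] at hf
      exact (Ideal.add_mem_iff_left _ (Ideal.mul_mem_right _ _ hquad)).mp hf
    have hrb : r * b = -(a * s) := by
      rw [hP, map_add, map_mul, hφC, hφC, hφX] at hrsP
      apply hinj
      simp only [map_mul, map_neg]
      field_simp at hrsP
      linear_combination hrsP
    have hr : r ∈ maximalIdeal A := by
      intro hu
      refine h.not_dvd ((hu.dvd_mul_left).mp ⟨-s, ?_⟩)
      rw [hrb]
      ring
    obtain ⟨c', hc', hcc'⟩ := h.mul r hr
    have hs : s = -c' := by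
      apply mul_left_cancel₀ h.ne_zero
      linear_combination hrb - hcc'
    rw [hN, ← hmod]
    simp only [eval_add, eval_mul, eval_C, eval_X, eval_sub, eval_pow]
    refine add_mem (add_mem (Ideal.mul_mem_right _ _ hr) ?_) (Ideal.mul_mem_right _ _ ?_)
    · rw [hs]
      exact neg_mem hc'
    · simpa using hg
  have hpow : ∀ (Q : PrimeSpectrum A[X]), Q ≤ P → ∀ f ∈ P.asIdeal,
      C a * X - C b ∈ Q.asIdeal → f ∈ Q.asIdeal := by
    intro Q hQ f hf hab
    obtain ⟨k, c, hc⟩ := exists_C_pow_mul_sub_C_mem_span a b f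
    have hcQ := (Ideal.span_singleton_le_iff_mem _).mpr hab hc
    have hc0 : c = 0 := hCP c <| (Submodule.sub_mem_iff_right _
      (Ideal.mul_mem_left _ _ hf)).mp (hQ hcQ)
    rw [hc0, map_zero, sub_zero] at hcQ
    refine (Q.2.mem_or_mem hcQ).resolve_left fun h' => h.ne_zero ?_
    exact hCP a (hQ (Q.2.mem_of_pow_mem _ h'))
  have habP : C a * X - C b ∈ P.asIdeal := hlin a b rfl
  have hab0 : (C a * X - C b : A[X]) ≠ 0 := fun h0 => h.ne_zero <| by
    simpa using congrArg (fun f => coeff f 1) h0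
  have hbot : (⊥ : PrimeSpectrum A[X]) < P :=
    lt_of_le_of_ne bot_le fun heq => hab0 <| by
      rw [← heq] at habP
      exact habP
  have hcov₁ : ⊥ ⋖ P := by
    refine covBy_of_mem_minimalPrimes_sup (I := ⊥) (x := C a * X - C b) bot_le ?_ hbot
    rw [bot_sup_eq]
    refine ⟨⟨P.2, (Ideal.span_singleton_le_iff_mem _).mpr habP⟩, ?_⟩
    rintro Q ⟨hQ, hQab⟩ hQP f hf
    exact hpow ⟨Q, hQ⟩ hQP f hf ((Ideal.span_singleton_le_iff_mem _).mp hQab)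
  have hcov₂ : P ⋖ N := by
    refine ⟨lt_of_le_of_ne hPN ?_, ?_⟩
    · rintro heq
      refine h.ne_zero (hCP a ?_)
      rw [heq, hN]
      simpa using ham
    rintro Q hPQ hQN
    obtain ⟨f, hfQ, hfP⟩ := SetLike.exists_of_lt (show P.asIdeal < Q.asIdeal from hPQ)
    obtain ⟨k, d, hkd⟩ := exists_C_pow_mul_sub_C_mem_span a b f
    have hkdP := (Ideal.span_singleton_le_iff_mem _).mpr habP hkd
    have hd : d ≠ 0 := by
      rintro rfl
      rw [map_zero, sub_zero] at hkdP
      refine (P.2.mem_or_mem hkdP).elim (fun h' => h.ne_zero ?_) hfP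
      exact hCP a (P.2.mem_of_pow_mem _ h')
    have hdQ : C d ∈ Q.asIdeal := (Submodule.sub_mem_iff_right _
      (Ideal.mul_mem_left _ _ hfQ)).mp (hPQ.le hkdP)
    obtain ⟨M, hM⟩ := h.exists_pow d hd
    let ψ : A[X] →+* A[X] ⧸ Q.asIdeal := Ideal.Quotient.mk Q.asIdeal
    let J : Ideal (A[X] ⧸ Q.asIdeal) := (maximalIdeal A ^ M).map (ψ.comp C)
    have hψ : ∀ f, ψ f = 0 ↔ f ∈ Q.asIdeal := fun f => Ideal.Quotient.eq_zero_iff_mem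
    have hJ : J ≤ N.asIdeal.map ψ • J := by
      refine Ideal.map_le_iff_le_comap.mpr fun c hc => ?_
      obtain ⟨c', hc', hcc'⟩ := hM c hc
      obtain ⟨y, hy, z, hz, rfl⟩ := Submodule.mem_sup.mp hc'
      obtain ⟨e, rfl⟩ := Ideal.mem_span_singleton.mp hy
      have h₁ := (hψ _).mpr (hPQ.le (hlin _ _ hcc'))
      have h₂ := (hψ _).mpr hdQ
      have h₃ : ψ (C c) = ψ (C z) - ψ (X - 1) * ψ (C c) := by
        simp only [map_sub, map_mul, map_add, map_one] at h₁ h₂ ⊢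
        linear_combination h₁ + ψ (C e) * h₂
      rw [Ideal.mem_comap, RingHom.comp_apply, h₃, smul_eq_mul]
      refine sub_mem ?_ (Ideal.mul_mem_mul (Ideal.mem_map_of_mem _ ?_)
        (Ideal.mem_map_of_mem (ψ.comp C) hc))
      · have hle : (maximalIdeal A).map (ψ.comp C) ≤ N.asIdeal.map ψ := by
          rw [← Ideal.map_map]
          refine Ideal.map_mono (Ideal.map_le_iff_le_comap.mpr fun x hx => ?_)
          rw [Ideal.mem_comap, hN]
          simpa using hx
        have hz' := Ideal.mem_map_of_mem (ψ.comp C) hz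
        rw [pow_succ', Ideal.map_mul] at hz'
        exact Ideal.mul_mono_left hle hz'
      · rw [hN]
        simp
    obtain ⟨r, hr, hrJ⟩ := Submodule.exists_sub_one_mem_and_smul_eq_zero_of_fg_of_le_smul _ J
      (IsNoetherian.noetherian J) hJ
    obtain ⟨ρ, rfl⟩ := Ideal.Quotient.mk_surjective r
    have hρ : ρ - 1 ∈ N.asIdeal := by
      have : ψ (ρ - 1) ∈ N.asIdeal.map ψ := by
        rw [map_sub, map_one]
        exact hr
      rw [← Ideal.mem_comap, Ideal.comap_map_of_surjective ψ Ideal.Quotient.mk_surjective,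
        ← RingHom.ker_eq_comap_bot, Ideal.mk_ker, sup_eq_left.mpr hQN.le] at this
      exact this
    have hρQ : ρ ∉ Q.asIdeal := fun hρ' => N.2.ne_top <| by
      rw [Ideal.eq_top_iff_one]
      simpa using sub_mem (hQN.le hρ') hρ
    have hmQ : maximalIdeal A ≤ Q.asIdeal.comap C := by
      refine Ideal.IsPrime.le_of_pow_le (n := M) fun c hc => ?_
      have hc0 := hrJ _ (Ideal.mem_map_of_mem (ψ.comp C) hc)
      rw [smul_eq_mul] at hc0
      have hmem : ρ * C c ∈ Q.asIdeal := by
        rw [← hψ, map_mul]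
        exact hc0
      exact (Q.2.mem_or_mem hmem).resolve_left hρQ
    have hX : (X - 1 : A[X]) ∈ Q.asIdeal := by
      have h₁ : (X * (X - 1) : A[X]) ∈ Q.asIdeal := by
        have := add_mem (hPQ.le hquad) (hmQ hg)
        convert this using 1
        ring
      refine (Q.2.mem_or_mem h₁).resolve_left fun hX => ?_
      have := hQN.le hX
      rw [hN, eval_X] at this
      exact (maximalIdeal A).ne_top_iff_one.mp (maximalIdeal.isMaximal A).ne_top this
    refine not_le_of_gt hQN fun f hf => ?_
    obtain ⟨k, hk⟩ := X_sub_C_dvd_sub_C_eval (a := (1 : A)) (p := f)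
    rw [map_one] at hk
    rw [← sub_add_cancel f (C (f.eval 1)), hk]
    exact add_mem (Ideal.mul_mem_right _ _ hX) (hmQ hf)
  have hNA : N.asIdeal.LiesOver (maximalIdeal A) := ⟨by
    ext c
    simp [Ideal.under, N]⟩
  have hN₂ := hcat.height_le_two hcov₁ hcov₂
  have hNmax' : N.asIdeal.IsMaximal := hNmax
  rw [← PrimeSpectrum.height_eq_orderHeight,
    height_eq_height_add_one (maximalIdeal A) N.asIdeal] at hN₂
  have : (2 + 1 : ℕ∞) ≤ 2 := (by gcongr : (2 + 1 : ℕ∞) ≤ (maximalIdeal A).height + 1).trans hN₂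
  exact absurd this (by norm_num)

end

theorem isTwoBranched_comap {K : Type} [Field K] {n : ℕ} (hn : 1 < n) {T : Type} [CommRing T]
    [IsLocalRing T] (e : T ≃+* exRing K n) :
    IsTwoBranched ((exP₁ K n).comap e) ((exP₂ K n).comap e) := by
  have hmap : ∀ I : Ideal (exRing K n), (I.comap e).map e = I := fun I =>
    Ideal.map_comap_of_surjective _ e.surjective _
  have hle : ∀ I J : Ideal (exRing K n), I.comap e ≤ J.comap e → I ≤ J := fun I J h => by
    rw [← hmap I, ← hmap J]
    exact Ideal.map_mono h
  let e₁ := Ideal.quotientEquiv _ _ e (hmap (exP₁ K n)).symm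
  let e₂ := Ideal.quotientEquiv _ _ e (hmap (exP₂ K n)).symm
  have hd₁ := (ringKrullDim_eq_of_ringEquiv e₁).trans (ringKrullDim_quotient_exP₁ K n)
  have hd₂ := (ringKrullDim_eq_of_ringEquiv e₂).trans (ringKrullDim_quotient_exP₂ K n)
  refine ⟨inferInstance, inferInstance, ?_, ?_, fun h => not_exP₁_le_exP₂ K n (hle _ _ h),
    fun h => not_exP₂_le_exP₁ K n (by omega) (hle _ _ h), ?_, ?_, hd₂.le⟩
  · rw [← Ideal.comap_inf, exP₁_inf_exP₂]
    exact (RingHom.injective_iff_ker_eq_bot (e : T →+* exRing K n)).mp e.injective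
  · intro t ht
    have hu : ¬ IsUnit (e t) := fun h => ht ((MulEquiv.isUnit_map e).mp h)
    obtain ⟨p, hp, q, hq, hpq⟩ := Submodule.mem_sup.mp (exRing_mem_sup K n _ hu)
    refine Submodule.mem_sup.mpr ⟨e.symm p, ?_, e.symm q, ?_, ?_⟩
    · change e (e.symm p) ∈ exP₁ K n
      rwa [e.apply_symm_apply]
    · change e (e.symm q) ∈ exP₂ K n
      rwa [e.apply_symm_apply]
    · rw [← map_add, hpq, e.symm_apply_apply]
  · intro _
    exact IsCMLocal.of_ringEquiv (e₁.trans (exQuotEquiv₁ K n)).symm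
      (MvPowerSeries.isCMLocal_fin K n)
  · rw [hd₁]
    exact_mod_cast hn

theorem IsTwoBranched.two_le_height {R : Type} [CommRing R] [IsLocalRing R] {P₁ P₂ : Ideal R}
    (h : IsTwoBranched P₁ P₂) : 2 ≤ (maximalIdeal R).height := by
  have h₁ := h.two_le_dim.trans
    (ringKrullDim_le_of_surjective (Ideal.Quotient.mk P₁) Ideal.Quotient.mk_surjective)
  rw [← maximalIdeal_height_eq_ringKrullDim] at h₁
  exact WithBot.coe_le_coe.mp h₁

theorem isCatenary_and_not_isUniversallyCatenary {K : Type} [Field K] {n : ℕ} (hn : 1 < n)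
    {A : Type} [CommRing A] [IsDomain A] [IsLocalRing A] [IsNoetherianRing A]
    (e : AdicCompletion (maximalIdeal A) A ≃+* exRing K n) :
    IsCatenary A ∧ ¬ IsUniversallyCatenary A := by
  let T := AdicCompletion (maximalIdeal A) A
  have : IsNoetherianRing T := isNoetherianRing_of_ringEquiv _ e.symm
  have : Module.Flat A T := AdicCompletion.flat_of_isNoetherian _
  have h := isTwoBranched_comap hn e
  have hmap : (maximalIdeal A).map (algebraMap A T) = maximalIdeal T :=
    AdicCompletion.maximalIdeal_eq_map.symm
  refine ⟨isCatenary_of_height_le fun p q hpq => h.height_le_of_covBy_base hpq, fun huniv => ?_⟩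
  have hres : ∀ t : T, ∃ c : A, t - algebraMap A T c ∈ maximalIdeal T := fun t => by
    obtain ⟨c, hc⟩ := (AdicCompletion.residueField_map_bijective A).2 (residue T t)
    obtain ⟨c, rfl⟩ := residue_surjective c
    refine ⟨c, ?_⟩
    rw [← residue_eq_zero_iff, map_sub, ← hc, ResidueField.map_residue, sub_self]
  have hdim : 2 ≤ (maximalIdeal A).height := by
    have hmin : maximalIdeal T ∈ ((maximalIdeal A).map (algebraMap A T)).minimalPrimes := by
      rw [hmap, Ideal.minimalPrimes_eq_subsingleton_self]
      rfl
    rw [← Ideal.height_eq_of_mem_minimalPrimes_map hmin]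
    exact h.two_le_height
  have hne : maximalIdeal A ≠ ⊥ := fun h0 => by
    rw [h0, Ideal.height_bot] at hdim
    exact absurd hdim (by norm_num)
  obtain ⟨a, ham, ha⟩ := Submodule.exists_mem_ne_zero_of_ne_bot hne
  obtain ⟨b, hb⟩ := h.exists_isBranchPair hmap hres ha ham
  exact hb.not_isCatenary_polynomial ham hdim
    ((huniv 1).of_ringEquiv (MvPolynomial.uniqueAlgEquiv A (Fin 1)).toRingEquiv)

/-- Let `T = K⟦x, y₁, …, y_n⟧/((x) ∩ (y₁, …, y_n))` with `K` a field and `n > 1`.  Then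
`T` has exactly two minimal primes `P₁` (the image of `(x)`) and `P₂` (the image of
`(y₁, …, y_n)`) with `dim (T/P₁) = n` and `dim (T/P₂) = 1`, and `T` is not
equidimensional; consequently every Noetherian local domain `A` whose completion is
isomorphic to `T` is catenary but not universally catenary. -/
theorem stmt19 (K : Type) [Field K] (n : ℕ) (hn : 1 < n) :
    minimalPrimes (exRing K n) =
      {Ideal.map (Ideal.Quotient.mk (exIdeal K n))
          (Ideal.span {MvPowerSeries.X (Sum.inl ())}),
        Ideal.map (Ideal.Quotient.mk (exIdeal K n))
          (Ideal.span (Set.range fun i : Fin n => MvPowerSeries.X (Sum.inr i)))} ∧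
    ringKrullDim (exRing K n ⧸ Ideal.map (Ideal.Quotient.mk (exIdeal K n))
        (Ideal.span {MvPowerSeries.X (Sum.inl ())})) = (n : WithBot ℕ∞) ∧
    ringKrullDim (exRing K n ⧸ Ideal.map (Ideal.Quotient.mk (exIdeal K n))
        (Ideal.span (Set.range fun i : Fin n => MvPowerSeries.X (Sum.inr i))))
      = (1 : WithBot ℕ∞) ∧
    ¬ IsEquidimensional (exRing K n) ∧
    ∀ (A : Type) [CommRing A] [IsDomain A] [IsLocalRing A] [IsNoetherianRing A],
      Nonempty (AdicCompletion (maximalIdeal A) A ≃+* exRing K n) →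
      IsCatenary A ∧ ¬ IsUniversallyCatenary A :=
  ⟨minimalPrimes_exRing K n (by omega), ringKrullDim_quotient_exP₁ K n,
    ringKrullDim_quotient_exP₂ K n, not_isEquidimensional_exRing K n hn,
    fun _ _ _ _ _ ⟨e⟩ => isCatenary_and_not_isUniversallyCatenary hn e⟩
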